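/- For every map φ : [0,∞) → [0,∞) satisfying φ(t) = o(t^{1/3}) as t → ∞, there exists a strongly mixing rank-one system which is φ-integrably orbit equivalent to the universal odometer. -/

import Mathlib

/-- A measure-theoretic dynamical system: an invertible bimeasurable transformation
of a measure space. -/
structure MSystem where
  carrier : Type
  [meas : MeasurableSpace carrier]
  μ : MeasureTheory.Measure carrier
  T : carrier ≃ᵐ carrier

attribute [instance] MSystem.meas

open MeasureTheory Filter Set Topology

/-- A cutting and spacing parameter: an integer `q ≥ 2` (the cutting parameter) together
with nonnegative integers `σ 0, …, σ q` (the spacing parameters), represented as a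
function `ℕ → ℕ` vanishing above `q`. -/
structure CSParam where
  q : ℕ
  two_le_q : 2 ≤ q
  σ : ℕ → ℕ
  σ_eq_zero_of_gt : ∀ i, q < i → σ i = 0

/-- The total number `σ_n = σ_{n,0} + ⋯ + σ_{n,q_n}` of spacers added at one step. -/
def CSParam.σtot (P : CSParam) : ℕ := ∑ i ∈ Finset.range (P.q + 1), P.σ i

/-- The height sequence associated with a sequence of cutting and spacing parameters:
`h 0 = 1` and `h (n+1) = q_n · h_n + σ_n`. -/
def heights (p : ℕ → CSParam) : ℕ → ℕ
  | 0 => 1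
  | n + 1 => (p n).q * heights p n + (p n).σtot

/-- `Z_n`, the maximum spacing parameter over the first `n+1` steps. -/
def Zmax (p : ℕ → CSParam) (n : ℕ) : ℕ :=
  (Finset.range (n + 1)).sup fun j => (Finset.range ((p j).q + 1)).sup (p j).σ

/-- Condition (F): the series `Σ σ_n / h_{n+1}` converges. -/
def CondF (p : ℕ → CSParam) : Prop :=
  Summable fun n => ((p n).σtot : ℝ) / (heights p (n + 1) : ℝ)

/-- The level of the `(n+1)`-th tower at which the `i`-th subcolumn of the `n`-th
tower starts, namely `σ_{n,0} + ⋯ + σ_{n,i} + i·h_n`. -/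
def colStart (p : ℕ → CSParam) (n i : ℕ) : ℕ :=
  (∑ j ∈ Finset.range (i + 1), (p n).σ j) + i * heights p n

/-- The subset `X_n` covered by the `n`-th tower. -/
def towerUnion {X : Type} [MeasurableSpace X] (T : X ≃ᵐ X) (p : ℕ → CSParam)
    (B : ℕ → Set X) (n : ℕ) : Set X :=
  ⋃ k ∈ Finset.range (heights p n), (⇑T)^[k] '' B n

/-- A cutting-and-stacking tower structure for `T`, with parameters `p`, bases `B n`
(so that the `n`-th tower has levels `T^k (B n)`, `k < h_n`), and subdivision
`Bsub n 0, …, Bsub n (q_n - 1)` of `B n`: the `(n+1)`-th tower is obtained by stacking,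
in order, `σ_{n,0}` spacer levels, the subcolumn over `Bsub n 0`, `σ_{n,1}` spacer levels,
…, the subcolumn over `Bsub n (q_n-1)`, and `σ_{n,q_n}` spacer levels on top, the spacer
levels being disjoint from `X_n`. -/
structure IsCuttingStacking {X : Type} [MeasurableSpace X] (T : X ≃ᵐ X)
    (p : ℕ → CSParam) (B : ℕ → Set X) (Bsub : ℕ → ℕ → Set X) : Prop where
  meas_base : ∀ n, MeasurableSet (B n)
  meas_sub : ∀ n, ∀ i < (p n).q, MeasurableSet (Bsub n i)
  disj_levels : ∀ n, ∀ k < heights p n, ∀ l < heights p n, k ≠ l →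
    Disjoint ((⇑T)^[k] '' B n) ((⇑T)^[l] '' B n)
  disj_sub : ∀ n, ∀ i < (p n).q, ∀ j < (p n).q, i ≠ j → Disjoint (Bsub n i) (Bsub n j)
  union_sub : ∀ n, B n = ⋃ i ∈ Finset.range (p n).q, Bsub n i
  subcolumn : ∀ n, ∀ i < (p n).q, ∀ k < heights p n,
    (⇑T)^[colStart p n i + k] '' B (n + 1) = (⇑T)^[k] '' Bsub n i
  spacer_disjoint : ∀ n, ∀ l < heights p (n + 1),
    (∀ i < (p n).q, ∀ k < heights p n, l ≠ colStart p n i + k) →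
    Disjoint ((⇑T)^[l] '' B (n + 1)) (towerUnion T p B n)

/-- The towers with bases `B n` increase to the full σ-algebra modulo `μ`-null sets. -/
def TowersGenerate {X : Type} [MeasurableSpace X] (μ : Measure X) (T : X ≃ᵐ X)
    (p : ℕ → CSParam) (B : ℕ → Set X) : Prop :=
  ∀ A : Set X, MeasurableSet A → ∃ A' : Set X,
    MeasurableSet[MeasurableSpace.generateFrom
      {s : Set X | ∃ n k, k < heights p n ∧ s = (⇑T)^[k] '' B n}] A' ∧
    μ (symmDiff A A') = 0

/-- `T` is a rank-one system with cutting and spacing parameters `p` on `(X, μ)`. -/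
def IsRankOneWith {X : Type} [MeasurableSpace X] (μ : Measure X) (T : X ≃ᵐ X)
    (p : ℕ → CSParam) : Prop :=
  MeasurePreserving T μ μ ∧ CondF p ∧
    ∃ B Bsub, IsCuttingStacking T p B Bsub ∧ TowersGenerate μ T p B

/-- `T` is a rank-one system on `(X, μ)`. -/
def IsRankOne {X : Type} [MeasurableSpace X] (μ : Measure X) (T : X ≃ᵐ X) : Prop :=
  ∃ p, IsRankOneWith μ T p

/-- Iterates, indexed by `ℤ`, of a measurable equivalence. -/
def zIter {X : Type} [MeasurableSpace X] (T : X ≃ᵐ X) (n : ℤ) (x : X) : X :=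
  if 0 ≤ n then (⇑T)^[n.toNat] x else (⇑T.symm)^[(-n).toNat] x

/-- The `T`-orbit of a point. -/
def orbit {X : Type} [MeasurableSpace X] (T : X ≃ᵐ X) (x : X) : Set X :=
  Set.range fun n : ℤ => zIter T n x

/-- `S` is the universal odometer: a rank-one system admitting a construction with no
spacers whose cutting parameters `q'_n` are such that every positive integer divides
some product `q'_0 ⋯ q'_{n-1}`. -/
def IsUniversalOdometer {X : Type} [MeasurableSpace X] (μ : Measure X) (S : X ≃ᵐ X) : Prop :=
  ∃ p : ℕ → CSParam, IsRankOneWith μ S p ∧ (∀ n i, (p n).σ i = 0) ∧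
    ∀ N : ℕ, 0 < N → ∃ n, N ∣ ∏ k ∈ Finset.range n, (p k).q

/-- `T` (acting on `(X,μ)`) and `S` (acting on `(Y,ν)`) are φ-integrably orbit
equivalent: there is a measure-preserving bimeasurable bijection matching a.e. `T`-orbit
with the corresponding `S`-orbit, whose cocycles `c_T`, `c_S` satisfy
`∫ φ(|c_T|) dμ < ∞` and `∫ φ(|c_S|) dν < ∞`. -/
def PhiIntegrablyOE {X Y : Type} [MeasurableSpace X] [MeasurableSpace Y]
    (μ : Measure X) (T : X ≃ᵐ X) (ν : Measure Y) (S : Y ≃ᵐ Y) (φ : ℝ → ℝ) : Prop :=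
  ∃ Ψ : X ≃ᵐ Y, MeasurePreserving Ψ μ ν ∧
    (∀ᵐ x ∂μ, Ψ '' orbit T x = orbit S (Ψ x)) ∧
    ∃ cT : X → ℤ, ∃ cS : Y → ℤ,
      Measurable cT ∧ Measurable cS ∧
      (∀ᵐ x ∂μ, Ψ (T x) = zIter S (cT x) (Ψ x)) ∧
      (∀ᵐ y ∂ν, Ψ.symm (S y) = zIter T (cS y) (Ψ.symm y)) ∧
      Integrable (fun x => φ |(cT x : ℝ)|) μ ∧
      Integrable (fun y => φ |(cS y : ℝ)|) ν

/-- The underlying space is a standard atomless probability space. -/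
def MSystem.Standard (𝒮 : MSystem) : Prop :=
  StandardBorelSpace 𝒮.carrier ∧ IsProbabilityMeasure 𝒮.μ ∧ NoAtoms 𝒮.μ

/-- `T` is φ-integrably orbit equivalent to the universal odometer. -/
def PhiOEToUnivOdometer {X : Type} [MeasurableSpace X] (μ : Measure X) (T : X ≃ᵐ X)
    (φ : ℝ → ℝ) : Prop :=
  ∃ 𝒮 : MSystem, 𝒮.Standard ∧ IsUniversalOdometer 𝒮.μ 𝒮.T ∧
    PhiIntegrablyOE μ T 𝒮.μ 𝒮.T φ

/-- `φ(t) = o(t^{1/3})` as `t → ∞`. -/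
def SmallOCbrt (φ : ℝ → ℝ) : Prop :=
  Tendsto (fun t : ℝ => φ t / t ^ ((1 : ℝ) / 3)) atTop (nhds 0)

/-- `T` is strongly mixing on `(X,μ)`: `|μ(A ∩ T⁻ⁿB) − μ(A)μ(B)| → 0` for all
measurable `A`, `B`. -/
def StronglyMixing {X : Type} [MeasurableSpace X] (μ : MeasureTheory.Measure X)
    (T : X → X) : Prop :=
  ∀ A B : Set X, MeasurableSet A → MeasurableSet B →
    Filter.Tendsto
      (fun n : ℕ => |(μ (A ∩ T^[n] ⁻¹' B)).toReal - (μ A).toReal * (μ B).toReal|)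
      Filter.atTop (nhds 0)

/-- An adic presentation of a cutting-and-stacking construction on `∏ n, Fin (Q n)`: the map
`F n` gives the position in the `(n+1)`-st tower from the position in the `n`-th one and the
`n`-th digit, and `col n j` is the digit of the `j`-th copy of the `n`-th tower. The remaining
digits encode spacers. -/
structure Adic (Q h : ℕ → ℕ) where
  h_zero : h 0 = 1
  h_succ : ∀ n, h (n + 1) = h n * Q n
  two_le : ∀ n, 2 ≤ Q n
  p : ℕ → CSParam
  heights_eq : ∀ n, heights p n = h n
  condF : CondF p
  F : ℕ → ℕ → ℕ → ℕ
  F_lt : ∀ n t i, t < h n → i < Q n → F n t i < h (n + 1)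
  F_inj : ∀ n t i t' i', t < h n → i < Q n → t' < h n → i' < Q n →
    F n t i = F n t' i' → t = t' ∧ i = i'
  col : ℕ → ℕ → ℕ
  col_lt : ∀ n j, j < (p n).q → col n j < Q n
  F_col : ∀ n j t, j < (p n).q → t < h n → F n t (col n j) = colStart p n j + t

/-- Sequences of digits. -/
abbrev Digits (Q : ℕ → ℕ) : Type := ∀ n, Fin (Q n)

namespace Adic

variable {Q h : ℕ → ℕ} (A : Adic Q h)

include A in
lemma h_pos (n : ℕ) : 0 < h n := by
  induction n with
  | zero => simp [A.h_zero]
  | succ n ih => rw [A.h_succ]; have := A.two_le n; positivity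

include A in
lemma two_pow_le_h (n : ℕ) : 2 ^ n ≤ h n := by
  induction n with
  | zero => simp [A.h_zero]
  | succ n ih => rw [A.h_succ, pow_succ]; exact Nat.mul_le_mul ih (A.two_le n)

include A in
lemma h_eq_prod (n : ℕ) : h n = ∏ k ∈ Finset.range n, Q k := by
  induction n with
  | zero => simp [A.h_zero]
  | succ n ih => rw [A.h_succ, Finset.prod_range_succ, ih]

lemma F_surj (n p : ℕ) (hp : p < h (n + 1)) : ∃ t < h n, ∃ i < Q n, A.F n t i = p := by
  have key : (Finset.range (h n) ×ˢ Finset.range (Q n)).image (fun z => A.F n z.1 z.2)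
      = Finset.range (h (n + 1)) := by
    apply Finset.eq_of_subset_of_card_le
    · intro y hy
      simp only [Finset.mem_image, Finset.mem_product, Finset.mem_range, Prod.exists] at hy ⊢
      obtain ⟨t, i, ⟨ht, hi⟩, rfl⟩ := hy
      exact A.F_lt n t i ht hi
    · rw [Finset.card_image_of_injOn]
      · simp [A.h_succ]
      · rintro ⟨t, i⟩ h1 ⟨t', i'⟩ h2 he
        simp only [Finset.coe_product, Finset.coe_range, mem_prod, mem_Iio] at h1 h2
        have := A.F_inj n t i t' i' h1.1 h1.2 h2.1 h2.2 he
        simp [this.1, this.2]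
  have : p ∈ (Finset.range (h n) ×ˢ Finset.range (Q n)).image (fun z => A.F n z.1 z.2) := by
    rw [key]; simpa using hp
  simp only [Finset.mem_image, Finset.mem_product, Finset.mem_range, Prod.exists] at this
  obtain ⟨t, i, ⟨ht, hi⟩, rfl⟩ := this
  exact ⟨t, ht, i, hi, rfl⟩

/-- The position of `x` in the `n`-th tower. -/
def pos : ℕ → Digits Q → ℕ
  | 0, _ => 0
  | n + 1, x => A.F n (pos n x) (x n)

@[simp] lemma pos_zero (x : Digits Q) : A.pos 0 x = 0 := rfl

lemma pos_succ (n : ℕ) (x : Digits Q) : A.pos (n + 1) x = A.F n (A.pos n x) (x n) := rfl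

lemma pos_lt (n : ℕ) (x : Digits Q) : A.pos n x < h n := by
  induction n with
  | zero => simp [A.h_zero]
  | succ n ih => exact A.F_lt _ _ _ ih (x n).2

lemma pos_congr {n : ℕ} {x y : Digits Q} (hxy : ∀ m < n, x m = y m) :
    A.pos n x = A.pos n y := by
  induction n with
  | zero => rfl
  | succ n ih =>
    rw [pos_succ, pos_succ, ih fun m hm => hxy m (by omega), hxy n (by omega)]

lemma pos_eq_iff {n : ℕ} {x y : Digits Q} :
    A.pos n x = A.pos n y ↔ ∀ m < n, x m = y m := by
  refine ⟨fun hp => ?_, A.pos_congr⟩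
  induction n with
  | zero => intro m hm; omega
  | succ n ih =>
    obtain ⟨h1, h2⟩ := A.F_inj n _ _ _ _ (A.pos_lt n x) (x n).2 (A.pos_lt n y) (y n).2 hp
    intro m hm
    rcases Nat.lt_succ_iff_lt_or_eq.1 hm with h | rfl
    · exact ih h1 m h
    · exact Fin.ext h2

open Classical in
/-- Replace the first `n` digits of `x` by those of the position `t` of the `n`-th tower. -/
noncomputable def repl : ℕ → Digits Q → ℕ → Digits Q
  | 0, x, _ => x
  | n + 1, x, t =>
    if ht : t < h (n + 1) then
      Function.update (repl n x (A.F_surj n t ht).choose) n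
        ⟨(A.F_surj n t ht).choose_spec.2.choose, (A.F_surj n t ht).choose_spec.2.choose_spec.1⟩
    else x

lemma repl_spec (n : ℕ) (x : Digits Q) (t : ℕ) (ht : t < h n) :
    A.pos n (A.repl n x t) = t ∧ ∀ m ≥ n, A.repl n x t m = x m := by
  induction n generalizing t with
  | zero => rw [A.h_zero] at ht; simp [repl]; omega
  | succ n ih =>
    have h1 := (A.F_surj n t ht).choose_spec.1
    have h2 := (A.F_surj n t ht).choose_spec.2.choose_spec.2
    obtain ⟨i1, i2⟩ := ih _ h1
    constructor
    · rw [repl, dif_pos ht, pos_succ, Function.update_self]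
      rw [A.pos_congr (y := A.repl n x (A.F_surj n t ht).choose), i1]
      · exact h2
      · intro m hm; rw [Function.update_of_ne hm.ne]
    · intro m hm
      rw [repl, dif_pos ht, Function.update_of_ne (by omega)]
      exact i2 m (by omega)

lemma measurable_repl (n t : ℕ) : Measurable fun x : Digits Q => A.repl n x t := by
  induction n generalizing t with
  | zero => exact measurable_id
  | succ n ih =>
    by_cases ht : t < h (n + 1)
    · simp only [repl, dif_pos ht]
      rw [measurable_pi_iff]
      intro m
      by_cases hm : m = n
      · subst hm; simp only [Function.update_self]; exact measurable_const
      · simp only [Function.update_of_ne hm]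
        exact (measurable_pi_apply m).comp (ih _)
    · simp only [repl, dif_neg ht]; exact measurable_id

lemma measurable_pos (n : ℕ) : Measurable (A.pos n) := by
  induction n with
  | zero => exact measurable_const
  | succ n ih =>
    exact (measurable_of_countable (fun z : ℕ × Fin (Q n) => A.F n z.1 z.2)).comp
      (ih.prodMk (measurable_pi_apply n))

/-- The digit `i` is the digit of a copy of the `n`-th tower in the `(n+1)`-st one. -/
def Good (n i : ℕ) : Prop := ∃ j < (A.p n).q, A.col n j = i

/-- The union of the levels of the `n`-th tower. -/
def dom (n : ℕ) : Set (Digits Q) := {x | ∀ m ≥ n, A.Good m (x m)}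

lemma dom_mono {m n : ℕ} (hmn : m ≤ n) : A.dom m ⊆ A.dom n :=
  fun _ hx k hk => hx k (hmn.trans hk)

lemma mem_dom_iff {n : ℕ} {x : Digits Q} :
    x ∈ A.dom n ↔ A.Good n (x n) ∧ x ∈ A.dom (n + 1) := by
  constructor
  · exact fun hx => ⟨hx n le_rfl, A.dom_mono (Nat.le_succ n) hx⟩
  · rintro ⟨h1, h2⟩ m hm
    rcases Nat.eq_or_lt_of_le hm with rfl | hm
    · exact h1
    · exact h2 m hm

lemma dom_congr {n : ℕ} {x y : Digits Q} (hxy : ∀ m ≥ n, x m = y m) (hx : x ∈ A.dom n) :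
    y ∈ A.dom n := fun m hm => hxy m hm ▸ hx m hm

lemma measurableSet_good (n : ℕ) : MeasurableSet {x : Digits Q | A.Good n (x n)} :=
  measurable_pi_apply (X := fun n => Fin (Q n)) n
    (MeasurableSet.of_discrete (s := {i : Fin (Q n) | A.Good n i}))

lemma measurableSet_dom (n : ℕ) : MeasurableSet (A.dom n) := by
  have : A.dom n = ⋂ m, ⋂ (_ : m ≥ n), {x : Digits Q | A.Good m (x m)} := by
    ext x; simp [dom]
  rw [this]
  exact MeasurableSet.iInter fun m => MeasurableSet.iInter fun _ => A.measurableSet_good m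

lemma pos_succ_of_col {n j : ℕ} {x : Digits Q} (hj : j < (A.p n).q) (hx : A.col n j = x n) :
    A.pos (n + 1) x = colStart A.p n j + A.pos n x := by
  rw [pos_succ, ← hx, A.F_col n j _ hj (A.pos_lt n x)]

lemma colStart_add_lt {n j t : ℕ} (hj : j < (A.p n).q) (ht : t < h n) :
    colStart A.p n j + t < h (n + 1) := by
  rw [← A.F_col n j t hj ht]
  exact A.F_lt _ _ _ ht (A.col_lt n j hj)

/-- `y` is obtained from `x` by moving `d` levels up in the `n`-th tower. -/
def Rel (n : ℕ) (d : ℤ) (x y : Digits Q) : Prop :=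
  x ∈ A.dom n ∧ (∀ m ≥ n, x m = y m) ∧ (A.pos n y : ℤ) = A.pos n x + d

variable {A}

lemma Rel.succ {n : ℕ} {d : ℤ} {x y : Digits Q} (hr : A.Rel n d x y) : A.Rel (n + 1) d x y := by
  obtain ⟨h1, h2, h3⟩ := hr
  refine ⟨A.dom_mono (Nat.le_succ n) h1, fun m hm => h2 m (by omega), ?_⟩
  obtain ⟨j, hj, hc⟩ := h1 n le_rfl
  rw [A.pos_succ_of_col hj hc, A.pos_succ_of_col hj (by rw [hc, h2 n le_rfl])]
  push_cast
  linarith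

lemma Rel.mono {n m : ℕ} (hnm : n ≤ m) {d : ℤ} {x y : Digits Q} (hr : A.Rel n d x y) :
    A.Rel m d x y := by
  induction m, hnm using Nat.le_induction with
  | base => exact hr
  | succ m _ ih => exact ih.succ

lemma Rel.unique {n m : ℕ} {d : ℤ} {x y z : Digits Q} (hy : A.Rel n d x y)
    (hz : A.Rel m d x z) : y = z := by
  have h1 := hy.mono (le_max_left n m)
  have h2 := hz.mono (le_max_right n m)
  have h3 : A.pos (max n m) y = A.pos (max n m) z := by
    have := h1.2.2; have := h2.2.2; omega
  rw [A.pos_eq_iff] at h3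
  funext k
  rcases lt_or_ge k (max n m) with hk | hk
  · exact h3 k hk
  · rw [← h1.2.1 k hk, h2.2.1 k hk]

lemma Rel.trans {n m : ℕ} {d e : ℤ} {x y z : Digits Q} (hy : A.Rel n d x y)
    (hz : A.Rel m e y z) : A.Rel (max n m) (d + e) x z := by
  have h1 := hy.mono (le_max_left n m)
  have h2 := hz.mono (le_max_right n m)
  refine ⟨h1.1, fun k hk => (h1.2.1 k hk).trans (h2.2.1 k hk), ?_⟩
  have := h1.2.2; have := h2.2.2; omega

lemma Rel.symm {n : ℕ} {d : ℤ} {x y : Digits Q} (hr : A.Rel n d x y) : A.Rel n (-d) y x :=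
  ⟨A.dom_congr hr.2.1 hr.1, fun m hm => (hr.2.1 m hm).symm, by rw [hr.2.2]; ring⟩

variable (A)

/-- The points of the `n`-th tower at distance at least `j` from the bottom and the top. -/
def inner (n j : ℕ) : Set (Digits Q) := {x | x ∈ A.dom n ∧ j ≤ A.pos n x ∧ A.pos n x + j < h n}

lemma inner_subset_succ (n j : ℕ) : A.inner n j ⊆ A.inner (n + 1) j := by
  rintro x ⟨h1, h2, h3⟩
  obtain ⟨i, hi, hc⟩ := h1 n le_rfl
  have := A.colStart_add_lt hi h3
  refine ⟨A.dom_mono (Nat.le_succ n) h1, ?_, ?_⟩ <;> rw [A.pos_succ_of_col hi hc] <;> omega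

lemma inner_mono (j : ℕ) : Monotone fun n => A.inner n j :=
  monotone_nat_of_le_succ fun n => A.inner_subset_succ n j

lemma measurableSet_inner (n j : ℕ) : MeasurableSet (A.inner n j) :=
  (A.measurableSet_dom n).inter
    (A.measurable_pos n (MeasurableSet.of_discrete (s := {t | j ≤ t ∧ t + j < h n})))

/-- The points whose whole orbit stays in the increasing union of the towers. -/
def core : Set (Digits Q) := ⋂ j, ⋃ n, A.inner n j

lemma mem_core {x : Digits Q} : x ∈ A.core ↔ ∀ j, ∃ n, x ∈ A.inner n j := by simp [core]

lemma measurableSet_core : MeasurableSet A.core :=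
  MeasurableSet.iInter fun j => MeasurableSet.iUnion fun n => A.measurableSet_inner n j

variable {A}

lemma Rel.mem_core {n : ℕ} {d : ℤ} {x y : Digits Q} (hr : A.Rel n d x y) (hx : x ∈ A.core) :
    y ∈ A.core := by
  rw [Adic.mem_core] at hx ⊢
  intro j
  obtain ⟨m, hm⟩ := hx (j + d.natAbs)
  have hm' := A.inner_mono _ (le_max_right n m) hm
  have hr' := hr.mono (le_max_left n m)
  have e := hr'.2.2
  obtain ⟨h1, h2, h3⟩ := hm'
  exact ⟨max n m, A.dom_congr hr'.2.1 h1, by omega, by omega⟩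

lemma rel_repl {n : ℕ} {d : ℤ} {x : Digits Q} (hx : x ∈ A.inner n d.natAbs) :
    A.Rel n d x (A.repl n x (A.pos n x + d).toNat) := by
  obtain ⟨h1, h2, h3⟩ := hx
  have h4 := A.repl_spec n x (A.pos n x + d).toNat (by omega)
  refine ⟨h1, fun m hm => (h4.2 m hm).symm, ?_⟩
  rw [h4.1]; omega

/-- Two points of the core with the same tail are in the same orbit. -/
lemma exists_rel_of_tail {n : ℕ} {x y : Digits Q} (hx : x ∈ A.core)
    (hxy : ∀ m ≥ n, x m = y m) : ∃ m d, A.Rel m d x y := by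
  obtain ⟨m, hm⟩ := A.mem_core.1 hx 0
  exact ⟨max n m, (A.pos (max n m) y : ℤ) - A.pos (max n m) x,
    A.dom_mono (le_max_right n m) hm.1, fun k hk => hxy k (le_of_max_le_left hk), by ring⟩

variable (A)

open Classical in
/-- The power `d` of the adic transformation. -/
noncomputable def move (d : ℤ) (x : Digits Q) : Digits Q :=
  if hx : x ∈ A.core then
    A.repl (Nat.find (A.mem_core.1 hx d.natAbs)) x
      (A.pos (Nat.find (A.mem_core.1 hx d.natAbs)) x + d).toNat
  else x

lemma move_of_notMem {d : ℤ} {x : Digits Q} (hx : x ∉ A.core) : A.move d x = x := dif_neg hx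

lemma exists_rel_move (d : ℤ) {x : Digits Q} (hx : x ∈ A.core) : ∃ n, A.Rel n d x (A.move d x) := by
  classical
  rw [move, dif_pos hx]
  exact ⟨_, rel_repl (Nat.find_spec (A.mem_core.1 hx d.natAbs))⟩

variable {A}

lemma Rel.move_eq {n : ℕ} {d : ℤ} {x y : Digits Q} (hr : A.Rel n d x y) (hx : x ∈ A.core) :
    A.move d x = y := by
  obtain ⟨m, hm⟩ := A.exists_rel_move d hx
  exact hm.unique hr

variable (A)

lemma move_move (d e : ℤ) (x : Digits Q) : A.move d (A.move e x) = A.move (e + d) x := by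
  by_cases hx : x ∈ A.core
  · obtain ⟨m, hm⟩ := A.exists_rel_move e hx
    obtain ⟨k, hk⟩ := A.exists_rel_move d (hm.mem_core hx)
    exact ((hm.trans hk).move_eq hx).symm
  · simp [A.move_of_notMem hx]

lemma move_zero (x : Digits Q) : A.move 0 x = x := by
  by_cases hx : x ∈ A.core
  · obtain ⟨n, hn⟩ := A.mem_core.1 hx 0
    exact Rel.move_eq (n := n) ⟨hn.1, fun _ _ => rfl, by ring⟩ hx
  · exact A.move_of_notMem hx

lemma measurable_move (d : ℤ) : Measurable (A.move d) := by
  classical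
  let N : Digits Q → ℕ := fun x =>
    if hx : x ∈ A.core then Nat.find (A.mem_core.1 hx d.natAbs) else 0
  have hN : Measurable N := by
    refine Measurable.dite (s := A.core)
      (f := fun x => Nat.find (A.mem_core.1 x.2 d.natAbs)) (g := fun _ => 0) ?_ measurable_const
      A.measurableSet_core
    exact measurable_find (p := fun (x : A.core) n => x.1 ∈ A.inner n d.natAbs)
      (fun x => A.mem_core.1 x.2 d.natAbs) fun n => measurable_subtype_coe (A.measurableSet_inner n _)
  have hG : Measurable fun z : ℕ × Digits Q => A.repl z.1 z.2 (A.pos z.1 z.2 + d).toNat := by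
    apply measurable_from_prod_countable_right
    intro n
    have h1 : Measurable fun z : ℕ × Digits Q => A.repl n z.2 z.1 :=
      measurable_from_prod_countable_right fun t => A.measurable_repl n t
    exact h1.comp (((measurable_of_countable fun t : ℕ => (t + d).toNat).comp
      (A.measurable_pos n)).prodMk measurable_id)
  have : A.move d = fun x => if x ∈ A.core then A.repl (N x) x (A.pos (N x) x + d).toNat else x := by
    funext x
    by_cases hx : x ∈ A.core
    · simp only [move, dif_pos hx, if_pos hx, N]
    · simp only [move, dif_neg hx, if_neg hx]
  rw [this]
  exact Measurable.ite A.measurableSet_core (hG.comp (hN.prodMk measurable_id)) measurable_id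

/-- The adic transformation. -/
noncomputable def T : Digits Q ≃ᵐ Digits Q where
  toFun := A.move 1
  invFun := A.move (-1)
  left_inv x := by rw [move_move]; exact A.move_zero x
  right_inv x := by rw [move_move]; exact A.move_zero x
  measurable_toFun := A.measurable_move 1
  measurable_invFun := A.measurable_move (-1)

lemma T_iterate (k : ℕ) (x : Digits Q) : (⇑A.T)^[k] x = A.move k x := by
  induction k with
  | zero => simp [A.move_zero]
  | succ k ih =>
    rw [Function.iterate_succ_apply', ih]
    exact (A.move_move 1 k x).trans (by push_cast; rfl)

lemma T_symm_iterate (k : ℕ) (x : Digits Q) : (⇑A.T.symm)^[k] x = A.move (-k) x := by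
  induction k with
  | zero => simp [A.move_zero]
  | succ k ih =>
    rw [Function.iterate_succ_apply', ih]
    refine (A.move_move (-1) (-k) x).trans ?_
    congr 1; push_cast; ring

lemma zIter_T (d : ℤ) (x : Digits Q) : zIter A.T d x = A.move d x := by
  unfold zIter
  split_ifs with hd
  · rw [T_iterate]; congr 1; omega
  · rw [T_symm_iterate]; congr 1; omega

lemma orbit_T {x : Digits Q} (hx : x ∈ A.core) :
    orbit A.T x = {y | ∃ n, ∀ m ≥ n, x m = y m} := by
  ext y
  simp only [orbit, mem_range, zIter_T, mem_ofPred_eq]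
  constructor
  · rintro ⟨d, rfl⟩
    obtain ⟨n, hn⟩ := A.exists_rel_move d hx
    exact ⟨n, hn.2.1⟩
  · rintro ⟨n, hn⟩
    obtain ⟨m, d, hm⟩ := exists_rel_of_tail hx hn
    exact ⟨d, hm.move_eq hx⟩

end Adic

/-- The product of the uniform probability measures. -/
noncomputable def digitMeasure (Q : ℕ → ℕ) [∀ n, NeZero (Q n)] : Measure (Digits Q) :=
  Measure.infinitePi fun n => (PMF.uniformOfFintype (Fin (Q n))).toMeasure

section digitMeasure
variable (Q : ℕ → ℕ) [∀ n, NeZero (Q n)]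

instance : IsProbabilityMeasure (digitMeasure Q) := by
  unfold digitMeasure; infer_instance

variable {Q}

lemma digitMeasure_cylinder (n : ℕ) (y : Digits Q) :
    digitMeasure Q {x | ∀ m < n, x m = y m} = (∏ k ∈ Finset.range n, (Q k : ENNReal))⁻¹ := by
  have h1 : {x : Digits Q | ∀ m < n, x m = y m} =
      Set.pi (Finset.range n) fun m => {y m} := by ext; simp [Set.mem_pi]
  rw [h1, digitMeasure, Measure.infinitePi_pi _ (fun _ _ => measurableSet_singleton _),
    ENNReal.prod_inv_distrib]
  · refine Finset.prod_congr rfl fun m _ => ?_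
    rw [PMF.toMeasure_apply_singleton _ _ (measurableSet_singleton _)]
    simp
  · intro a _ b _ _
    right; exact ENNReal.natCast_ne_top _

lemma digitMeasure_digit (n : ℕ) (S : Finset (Fin (Q n))) :
    (digitMeasure Q).real {x | x n ∈ S} = (S.card : ℝ) / Q n := by
  have h1 : {x : Digits Q | x n ∈ S} = (fun x => x n) ⁻¹' S := by ext; simp
  rw [measureReal_def, h1, ← Measure.map_apply (measurable_pi_apply n) (Finset.measurableSet S),
    digitMeasure, Measure.infinitePi_map_eval, PMF.toMeasure_uniformOfFintype_apply _
      (Finset.measurableSet S)]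
  simp [ENNReal.toReal_div]

end digitMeasure

namespace Adic

variable {Q h : ℕ → ℕ} (A : Adic Q h) [∀ n, NeZero (Q n)]

lemma digitMeasure_pos_eq (n p : ℕ) (hp : p < h n) :
    (digitMeasure Q).real {x | A.pos n x = p} = 1 / h n := by
  have hne : Nonempty (Digits Q) := ⟨fun n => 0⟩
  obtain ⟨h1, -⟩ := A.repl_spec n hne.some p hp
  have : {x | A.pos n x = p} = {x | ∀ m < n, x m = A.repl n hne.some p m} := by
    ext x
    change A.pos n x = p ↔ ∀ m < n, x m = A.repl n hne.some p m
    conv_lhs => rw [← h1]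
    exact A.pos_eq_iff
  rw [this, measureReal_def, digitMeasure_cylinder, A.h_eq_prod]
  simp [ENNReal.toReal_inv, ENNReal.toReal_prod]

lemma digitMeasure_pos_mem (n : ℕ) (S : Finset ℕ) (hS : S ⊆ Finset.range (h n)) :
    (digitMeasure Q).real {x | A.pos n x ∈ S} = (S.card : ℝ) / h n := by
  have : {x | A.pos n x ∈ S} = ⋃ p ∈ S, {x | A.pos n x = p} := by
    ext x; simp
  rw [this, measureReal_biUnion_finset]
  · rw [Finset.sum_congr rfl fun p hp => A.digitMeasure_pos_eq n p (Finset.mem_range.1 (hS hp))]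
    simp [div_eq_mul_inv]
  · intro a _ b _ hab
    rw [Function.onFun, Set.disjoint_left]
    intro x hx hx'
    exact hab (hx.symm.trans hx')
  · intro p _
    exact A.measurable_pos n (measurableSet_singleton p)

/-- The proportion of spacers among the levels of the `(n+1)`-st tower. -/
noncomputable def spacerRatio (n : ℕ) : ℝ := ((A.p n).σtot : ℝ) / h (n + 1)

omit [∀ n, NeZero (Q n)] in
lemma spacerRatio_nonneg (n : ℕ) : 0 ≤ A.spacerRatio n := by unfold spacerRatio; positivity

omit [∀ n, NeZero (Q n)] in
lemma summable_spacerRatio : Summable A.spacerRatio := by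
  have := A.condF
  unfold CondF at this
  simp only [A.heights_eq] at this
  exact this

omit [∀ n, NeZero (Q n)] in
lemma colStart_lt {n i j : ℕ} (hij : i < j) : colStart A.p n i < colStart A.p n j := by
  unfold colStart
  rw [A.heights_eq]
  have h1 : ∑ l ∈ Finset.range (i + 1), (A.p n).σ l ≤ ∑ l ∈ Finset.range (j + 1), (A.p n).σ l :=
    Finset.sum_le_sum_of_subset (by intro; simp; omega)
  have h2 : i * h n < j * h n := Nat.mul_lt_mul_of_pos_right hij (A.h_pos n)
  omega

omit [∀ n, NeZero (Q n)] in
lemma col_injOn (n : ℕ) : Set.InjOn (A.col n) (Set.Iio (A.p n).q) := by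
  intro i hi j hj hij
  have h1 := A.F_col n i 0 hi (A.h_pos n)
  rw [hij, A.F_col n j 0 hj (A.h_pos n)] at h1
  rcases lt_trichotomy i j with h2 | h2 | h2
  · have := A.colStart_lt (n := n) h2; omega
  · exact h2
  · have := A.colStart_lt (n := n) h2; omega

lemma digitMeasure_not_good (n : ℕ) :
    (digitMeasure Q).real {x | ¬ A.Good n (x n)} = A.spacerRatio n := by
  classical
  have h1 : (digitMeasure Q).real {x | A.Good n (x n)} = ((A.p n).q : ℝ) / Q n := by
    have : {x : Digits Q | A.Good n (x n)} =
        {x | x n ∈ (Finset.univ.filter fun i : Fin (Q n) => A.Good n i)} := by ext; simp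
    rw [this, digitMeasure_digit]
    congr 2
    rw [← Finset.card_range (A.p n).q, eq_comm]
    refine Finset.card_bij (fun j hj => ⟨A.col n j, A.col_lt n j (Finset.mem_range.1 hj)⟩) ?_ ?_ ?_
    · intro j hj
      simpa using ⟨j, Finset.mem_range.1 hj, rfl⟩
    · intro i hi j hj hij
      exact A.col_injOn n (Finset.mem_range.1 hi) (Finset.mem_range.1 hj) (Fin.ext_iff.1 hij)
    · intro b hb
      obtain ⟨j, hj, hc⟩ : A.Good n b := by simpa using hb
      exact ⟨j, Finset.mem_range.2 hj, Fin.ext hc⟩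
  have h2 : {x : Digits Q | ¬ A.Good n (x n)} = {x | A.Good n (x n)}ᶜ := rfl
  rw [h2, probReal_compl_eq_one_sub (A.measurableSet_good n), h1, spacerRatio]
  have h3 : heights A.p (n + 1) = (A.p n).q * heights A.p n + (A.p n).σtot := rfl
  rw [A.heights_eq, A.heights_eq, A.h_succ] at h3
  have h4 := A.h_pos n
  have h5 := A.two_le n
  have h6 : (h n : ℝ) * Q n = (A.p n).q * h n + (A.p n).σtot := by exact_mod_cast h3
  have h7 : (h n : ℝ) ≠ 0 := by positivity
  have h8 : (Q n : ℝ) ≠ 0 := by positivity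
  rw [A.h_succ]
  push_cast
  field_simp
  linarith

/-- The total proportion of spacers added after the `n`-th step. -/
noncomputable def tailRatio (n : ℕ) : ℝ := ∑' m, A.spacerRatio (m + n)

omit [∀ n, NeZero (Q n)] in
lemma tendsto_tailRatio : Tendsto A.tailRatio atTop (𝓝 0) := tendsto_sum_nat_add A.spacerRatio

omit [∀ n, NeZero (Q n)] in
lemma tailRatio_nonneg (n : ℕ) : 0 ≤ A.tailRatio n :=
  tsum_nonneg fun _ => A.spacerRatio_nonneg _

lemma digitMeasure_dom_compl (n : ℕ) : (digitMeasure Q).real (A.dom n)ᶜ ≤ A.tailRatio n := by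
  have h1 : (A.dom n)ᶜ = ⋃ m, {x : Digits Q | ¬ A.Good (m + n) (x (m + n))} := by
    ext x
    simp only [dom, mem_compl_iff, mem_ofPred_eq, mem_iUnion, not_forall]
    constructor
    · rintro ⟨m, hm, hg⟩
      exact ⟨m - n, by rwa [Nat.sub_add_cancel hm]⟩
    · rintro ⟨m, hm⟩
      exact ⟨m + n, by omega, hm⟩
  have hs : Summable fun m => A.spacerRatio (m + n) :=
    (summable_nat_add_iff n).2 A.summable_spacerRatio
  have h2 : digitMeasure Q (A.dom n)ᶜ ≤ ENNReal.ofReal (A.tailRatio n) := by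
    rw [h1, tailRatio, ENNReal.ofReal_tsum_of_nonneg (fun _ => A.spacerRatio_nonneg _) hs]
    refine (measure_iUnion_le _).trans (ENNReal.tsum_le_tsum fun m => ?_)
    rw [← A.digitMeasure_not_good, ofReal_measureReal]
  rw [measureReal_def]
  exact ENNReal.toReal_le_of_le_ofReal (A.tailRatio_nonneg n) h2

omit [∀ n, NeZero (Q n)] in
include A in
lemma one_div_h_le (n : ℕ) : (1 : ℝ) / h n ≤ (1 / 2) ^ n := by
  rw [one_div_pow]
  apply one_div_le_one_div_of_le (by positivity)
  exact_mod_cast A.two_pow_le_h n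

omit [∀ n, NeZero (Q n)] in
include A in
lemma tendsto_div_h (c : ℝ) : Tendsto (fun n => c / h n) atTop (𝓝 0) := by
  have h1 : Tendsto (fun n => (1 : ℝ) / h n) atTop (𝓝 0) :=
    squeeze_zero (fun n => by positivity) A.one_div_h_le
      (tendsto_pow_atTop_nhds_zero_of_lt_one (by norm_num) (by norm_num))
  simpa [div_eq_mul_inv] using h1.const_mul c

lemma digitMeasure_inner_compl (n j : ℕ) :
    (digitMeasure Q).real (A.inner n j)ᶜ ≤ A.tailRatio n + (2 * j : ℝ) / h n := by
  classical
  have h1 : (A.inner n j)ᶜ ⊆ (A.dom n)ᶜ ∪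
      {x | A.pos n x ∈ (Finset.range (h n)).filter fun t => t < j ∨ h n ≤ t + j} := by
    intro x hx
    by_contra hc
    simp only [mem_union, mem_compl_iff, not_or, not_not, mem_ofPred_eq, Finset.mem_filter,
      Finset.mem_range, A.pos_lt, true_and] at hc
    exact hx ⟨hc.1, by omega, by omega⟩
  refine (measureReal_mono h1).trans ((measureReal_union_le _ _).trans ?_)
  rw [digitMeasure_pos_mem _ _ _ (Finset.filter_subset _ _)]
  refine add_le_add (A.digitMeasure_dom_compl n) ?_
  gcongr
  have h2 : ((Finset.range (h n)).filter fun t => t < j ∨ h n ≤ t + j) ⊆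
      Finset.range j ∪ Finset.Ico (h n - j) (h n) := by
    intro t ht
    simp only [Finset.mem_filter, Finset.mem_range, Finset.mem_union, Finset.mem_Ico] at ht ⊢
    omega
  have h3 := (Finset.card_le_card h2).trans (Finset.card_union_le _ _)
  rw [Finset.card_range, Nat.card_Ico] at h3
  have h4 : ((Finset.range (h n)).filter fun t => t < j ∨ h n ≤ t + j).card ≤ 2 * j := by omega
  exact_mod_cast h4

lemma tendsto_inner_compl (j : ℕ) :
    Tendsto (fun n => (digitMeasure Q).real (A.inner n j)ᶜ) atTop (𝓝 0) := by
  refine squeeze_zero (fun n => measureReal_nonneg) (fun n => A.digitMeasure_inner_compl n j) ?_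
  simpa using A.tendsto_tailRatio.add (A.tendsto_div_h (2 * j))

lemma ae_mem_core : ∀ᵐ x ∂digitMeasure Q, x ∈ A.core := by
  have h0 : ∀ j, ∀ᵐ x ∂digitMeasure Q, ∃ n, x ∈ A.inner n j := by
    intro j
    rw [ae_iff]
    have h1 : (digitMeasure Q).real {x | ¬ ∃ n, x ∈ A.inner n j} ≤ 0 := by
      refine ge_of_tendsto' (A.tendsto_inner_compl j) fun n => measureReal_mono ?_
      intro x hx hx'
      exact hx ⟨n, hx'⟩
    have h2 := le_antisymm h1 measureReal_nonneg
    exact (measureReal_eq_zero_iff).1 h2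
  filter_upwards [ae_all_iff.2 h0] with x hx
  exact A.mem_core.2 hx

/-- Correlations are computed, up to a small error, by counting levels of a tower. -/
lemma abs_correlation_sub_le (n k : ℕ) (S S' : Finset ℕ) (hS : S ⊆ Finset.range (h n)) :
    |(digitMeasure Q).real ({x | A.pos n x ∈ S} ∩ (A.T)^[k] ⁻¹' {x | A.pos n x ∈ S'})
      - ((S.filter fun t => t + k ∈ S').card : ℝ) / h n| ≤
      A.tailRatio n + (2 * k : ℝ) / h n := by
  classical
  rw [← A.digitMeasure_pos_mem n (S.filter fun t => t + k ∈ S')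
    ((Finset.filter_subset _ _).trans hS)]
  refine le_trans ?_ (A.digitMeasure_inner_compl n k)
  have hcore : (digitMeasure Q).real (A.core)ᶜ = 0 := by
    rw [measureReal_eq_zero_iff]; exact A.ae_mem_core
  have key : ∀ x ∈ A.inner n k, x ∈ A.core →
      (x ∈ {x | A.pos n x ∈ S} ∩ (A.T)^[k] ⁻¹' {x | A.pos n x ∈ S'} ↔
      A.pos n x ∈ S.filter fun t => t + k ∈ S') := by
    intro x hx hc
    simp only [mem_inter_iff, mem_ofPred_eq, mem_preimage, Finset.mem_filter, T_iterate]
    have h1 := (rel_repl (d := k) (by simpa using hx)).move_eq hc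
    have h2 := (rel_repl (A := A) (d := k) (n := n) (x := x) (by simpa using hx)).2.2
    rw [← h1] at h2
    have h3 : A.pos n (A.move k x) = A.pos n x + k := by omega
    rw [h3]
  set U := {x | A.pos n x ∈ S} ∩ (A.T)^[k] ⁻¹' {x | A.pos n x ∈ S'}
  set V := {x | A.pos n x ∈ S.filter fun t => t + k ∈ S'}
  have hb : ∀ U V : Set (Digits Q), (∀ x ∈ A.inner n k, x ∈ A.core → (x ∈ U → x ∈ V)) →
      (digitMeasure Q).real U ≤ (digitMeasure Q).real V +
        (digitMeasure Q).real (A.inner n k)ᶜ := by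
    intro U V hUV
    have : U ⊆ (V ∪ (A.inner n k)ᶜ) ∪ A.coreᶜ := by
      intro x hx
      by_cases h1 : x ∈ A.inner n k
      · by_cases h2 : x ∈ A.core
        · exact Or.inl (Or.inl (hUV x h1 h2 hx))
        · exact Or.inr h2
      · exact Or.inl (Or.inr h1)
    calc _ ≤ _ := measureReal_mono this
      _ ≤ (digitMeasure Q).real (V ∪ (A.inner n k)ᶜ) + (digitMeasure Q).real A.coreᶜ :=
        measureReal_union_le _ _
      _ ≤ _ := by rw [hcore, add_zero]; exact measureReal_union_le _ _
  rw [abs_sub_le_iff]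
  constructor
  · linarith [hb U V fun x h1 h2 => (key x h1 h2).1]
  · linarith [hb V U fun x h1 h2 => (key x h1 h2).2]

/-- The cylinder sets. -/
def cylinders : Set (Set (Digits Q)) :=
  {C | ∃ n, ∃ S ⊆ Finset.range (h n), C = {x | A.pos n x ∈ S}}

omit [∀ n, NeZero (Q n)] in
lemma exists_cylinder_of_le {n m : ℕ} (hnm : n ≤ m) (S : Finset ℕ) :
    ∃ S' ⊆ Finset.range (h m), {x : Digits Q | A.pos n x ∈ S} = {x | A.pos m x ∈ S'} := by
  classical
  refine ⟨(Finset.range (h m)).filter fun t => ∃ y, A.pos m y = t ∧ A.pos n y ∈ S,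
    Finset.filter_subset _ _, ?_⟩
  ext x
  simp only [mem_ofPred_eq, Finset.mem_filter, Finset.mem_range, A.pos_lt, true_and]
  constructor
  · exact fun hx => ⟨x, rfl, hx⟩
  · rintro ⟨y, hy, hS⟩
    rw [A.pos_eq_iff] at hy
    rwa [A.pos_congr (y := y) fun k hk => (hy k (by omega)).symm]

omit [∀ n, NeZero (Q n)] in
lemma isSetAlgebra_cylinders : IsSetAlgebra A.cylinders where
  empty_mem := ⟨0, ∅, by simp, by simp⟩
  compl_mem := by
    rintro _ ⟨n, S, hS, rfl⟩
    refine ⟨n, Finset.range (h n) \ S, Finset.sdiff_subset, ?_⟩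
    ext x
    simp [A.pos_lt]
  union_mem := by
    rintro _ _ ⟨n, S, hS, rfl⟩ ⟨m, S', hS', rfl⟩
    obtain ⟨R, hR, e⟩ := A.exists_cylinder_of_le (le_max_left n m) S
    obtain ⟨R', hR', e'⟩ := A.exists_cylinder_of_le (le_max_right n m) S'
    refine ⟨max n m, R ∪ R', Finset.union_subset hR hR', ?_⟩
    rw [e, e']
    ext x; simp

omit [∀ n, NeZero (Q n)] in
lemma generateFrom_cylinders : MeasurableSpace.pi = MeasurableSpace.generateFrom A.cylinders := by
  classical
  apply le_antisymm
  · refine iSup_le fun n => ?_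
    rw [← measurable_iff_comap_le]
    refine @measurable_to_countable' _ _ _ _ (MeasurableSpace.generateFrom A.cylinders) _
      fun i => ?_
    apply MeasurableSpace.measurableSet_generateFrom
    refine ⟨n + 1, (Finset.range (h (n + 1))).filter fun t => ∃ y : Digits Q,
      A.pos (n + 1) y = t ∧ y n = i, Finset.filter_subset _ _, ?_⟩
    ext x
    simp only [mem_preimage, mem_singleton_iff, mem_ofPred_eq, Finset.mem_filter, Finset.mem_range,
      A.pos_lt, true_and]
    constructor
    · exact fun hx => ⟨x, rfl, hx⟩
    · rintro ⟨y, hy, rfl⟩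
      rw [A.pos_eq_iff] at hy
      exact (hy n (by omega)).symm
  · refine MeasurableSpace.generateFrom_le ?_
    rintro _ ⟨n, S, -, rfl⟩
    exact A.measurable_pos n (Finset.measurableSet S)

lemma measurePreserving_T : MeasurePreserving A.T (digitMeasure Q) (digitMeasure Q) := by
  refine ⟨A.T.measurable, ?_⟩
  refine ext_of_generate_finite _ A.generateFrom_cylinders ?_ ?_ ?_
  · rintro _ ⟨n, S, hS, rfl⟩ _ ⟨m, S', hS', rfl⟩ -
    exact A.isSetAlgebra_cylinders.inter_mem ⟨n, S, hS, rfl⟩ ⟨m, S', hS', rfl⟩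
  · rintro C ⟨m, S, hS, rfl⟩
    rw [A.T.map_apply, ← measureReal_eq_measureReal_iff, ← sub_eq_zero]
    have hlim : Tendsto (fun n => A.tailRatio n + 3 / h n) atTop (𝓝 0) := by
      simpa using A.tendsto_tailRatio.add (A.tendsto_div_h 3)
    have hle : ∀ᶠ n in atTop, |(digitMeasure Q).real (A.T ⁻¹' {x | A.pos m x ∈ S}) -
        (digitMeasure Q).real {x | A.pos m x ∈ S}| ≤ A.tailRatio n + 3 / h n := by
      filter_upwards [eventually_ge_atTop m] with n hn
      obtain ⟨R, hR, e⟩ := A.exists_cylinder_of_le hn S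
      rw [e, A.digitMeasure_pos_mem n R hR]
      have h1 := A.abs_correlation_sub_le n 1 (Finset.range (h n)) R subset_rfl
      have h2 : {x : Digits Q | A.pos n x ∈ Finset.range (h n)} = univ := by
        ext x; simp [A.pos_lt]
      rw [h2, univ_inter, Function.iterate_one] at h1
      have h3 : |(((Finset.range (h n)).filter fun t => t + 1 ∈ R).card : ℝ) / h n -
          (R.card : ℝ) / h n| ≤ 1 / h n := by
        rw [← sub_div, abs_div, abs_of_nonneg (Nat.cast_nonneg (α := ℝ) (h n))]
        gcongr
        have h4 : ((Finset.range (h n)).filter fun t => t + 1 ∈ R).card = (R.erase 0).card := by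
          refine Finset.card_bij (fun t _ => t + 1) ?_ ?_ ?_
          · intro t ht; simp at ht ⊢; exact ht.2
          · intro a _ b _ hab; omega
          · intro b hb
            simp only [Finset.mem_erase] at hb
            have := Finset.mem_range.1 (hR hb.2)
            refine ⟨b - 1, ?_, by omega⟩
            simp only [Finset.mem_filter, Finset.mem_range]
            exact ⟨by omega, by rw [Nat.sub_add_cancel (by omega)]; exact hb.2⟩
        rw [h4]
        have h5 := Finset.card_erase_le (s := R) (a := 0)
        have h6 := Finset.pred_card_le_card_erase (s := R) (a := 0)
        rw [abs_sub_le_iff]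
        have h7 : ((R.erase 0).card : ℝ) ≤ R.card := by exact_mod_cast h5
        have h8 : (R.card : ℝ) ≤ (R.erase 0).card + 1 := by
          exact_mod_cast (by omega : R.card ≤ (R.erase 0).card + 1)
        constructor <;> linarith
      refine (abs_sub_le _ _ _).trans ((add_le_add h1 h3).trans (le_of_eq ?_))
      push_cast
      ring
    have h9 := ge_of_tendsto hlim hle
    exact abs_eq_zero.1 (le_antisymm h9 (abs_nonneg _))
  · rw [A.T.map_apply, preimage_univ]

end Adic

namespace Adic

variable {Q h : ℕ → ℕ} (A : Adic Q h)

/-- The `k`-th level of the `n`-th tower. -/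
def level (n k : ℕ) : Set (Digits Q) := {x | x ∈ A.core ∧ x ∈ A.dom n ∧ A.pos n x = k}

/-- The part of the base of the `n`-th tower lying under its `i`-th copy in the next tower. -/
def subBase (n i : ℕ) : Set (Digits Q) :=
  {x | x ∈ A.core ∧ (x ∈ A.dom n ∧ A.col n i = x n) ∧ A.pos n x = 0}

lemma iterate_image {n k : ℕ} {V : Set (Digits Q)} (hk : k < h n)
    (hV : ∀ x y : Digits Q, (∀ m ≥ n, x m = y m) → x ∈ V → y ∈ V) (hVd : V ⊆ A.dom n) :
    (⇑A.T)^[k] '' {x | x ∈ A.core ∧ x ∈ V ∧ A.pos n x = 0} =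
      {x | x ∈ A.core ∧ x ∈ V ∧ A.pos n x = k} := by
  ext y
  simp only [mem_image, mem_ofPred_eq, T_iterate]
  constructor
  · rintro ⟨x, ⟨hc, hxV, hp⟩, rfl⟩
    obtain ⟨h1, h2⟩ := A.repl_spec n x k hk
    have hr : A.Rel n k x (A.repl n x k) :=
      ⟨hVd hxV, fun m hm => (h2 m hm).symm, by rw [h1, hp]; simp⟩
    rw [hr.move_eq hc]
    exact ⟨hr.mem_core hc, hV _ _ hr.2.1 hxV, h1⟩
  · rintro ⟨hc, hyV, hp⟩
    obtain ⟨h1, h2⟩ := A.repl_spec n y 0 (A.h_pos n)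
    have hr : A.Rel n (-k) y (A.repl n y 0) :=
      ⟨hVd hyV, fun m hm => (h2 m hm).symm, by rw [h1, hp]; simp⟩
    have hr' := hr.symm
    rw [neg_neg] at hr'
    exact ⟨A.repl n y 0, ⟨hr.mem_core hc, hV _ _ hr.2.1 hyV, h1⟩, hr'.move_eq (hr.mem_core hc)⟩

lemma iterate_level {n k : ℕ} (hk : k < h n) : (⇑A.T)^[k] '' A.level n 0 = A.level n k :=
  A.iterate_image hk (fun _ _ h1 h2 => A.dom_congr h1 h2) subset_rfl

lemma iterate_subBase {n i k : ℕ} (hk : k < h n) :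
    (⇑A.T)^[k] '' A.subBase n i =
      {x | x ∈ A.core ∧ (x ∈ A.dom n ∧ A.col n i = x n) ∧ A.pos n x = k} :=
  A.iterate_image (V := {x | x ∈ A.dom n ∧ A.col n i = x n}) hk
    (fun _ _ h1 h2 => ⟨A.dom_congr h1 h2.1, by rw [h2.2, h1 n le_rfl]⟩) fun _ hx => hx.1

lemma measurableSet_level (n k : ℕ) : MeasurableSet (A.level n k) :=
  A.measurableSet_core.inter ((A.measurableSet_dom n).inter
    (A.measurable_pos n (measurableSet_singleton k)))

lemma measurableSet_subBase (n i : ℕ) : MeasurableSet (A.subBase n i) :=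
  A.measurableSet_core.inter (((A.measurableSet_dom n).inter
    (measurable_pi_apply (X := fun n => Fin (Q n)) n
      (MeasurableSet.of_discrete (s := {j : Fin (Q n) | A.col n i = j})))).inter
    (A.measurable_pos n (measurableSet_singleton 0)))

lemma isCuttingStacking : IsCuttingStacking A.T A.p (fun n => A.level n 0) A.subBase where
  meas_base n := A.measurableSet_level n 0
  meas_sub n i _ := A.measurableSet_subBase n i
  disj_levels n k hk l hl hkl := by
    rw [A.heights_eq] at hk hl
    rw [A.iterate_level hk, A.iterate_level hl, Set.disjoint_left]
    exact fun x hx hx' => hkl (hx.2.2.symm.trans hx'.2.2)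
  disj_sub n i hi j hj hij := by
    rw [Set.disjoint_left]
    intro x hx hx'
    exact hij (A.col_injOn n hi hj (hx.2.1.2.trans hx'.2.1.2.symm))
  union_sub n := by
    ext x
    simp only [level, subBase, mem_iUnion, Finset.mem_range, mem_ofPred_eq]
    constructor
    · rintro ⟨h1, h2, h3⟩
      obtain ⟨j, hj, hc⟩ := h2 n le_rfl
      exact ⟨j, hj, h1, ⟨h2, hc⟩, h3⟩
    · rintro ⟨j, hj, h1, ⟨h2, hc⟩, h3⟩
      exact ⟨h1, h2, h3⟩
  subcolumn n i hi k hk := by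
    rw [A.heights_eq] at hk
    rw [A.iterate_level (A.colStart_add_lt hi hk), A.iterate_subBase hk]
    ext x
    simp only [level, mem_ofPred_eq]
    refine and_congr_right fun _ => ⟨?_, ?_⟩
    · rintro ⟨h1, h2⟩
      rw [← A.F_col n i k hi hk, pos_succ] at h2
      obtain ⟨h3, h4⟩ := A.F_inj n _ _ _ _ (A.pos_lt n x) (x n).2 hk (A.col_lt n i hi) h2
      exact ⟨⟨A.mem_dom_iff.2 ⟨⟨i, hi, h4.symm⟩, h1⟩, h4.symm⟩, h3⟩
    · rintro ⟨⟨h1, h2⟩, h3⟩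
      exact ⟨A.dom_mono (Nat.le_succ n) h1, by rw [A.pos_succ_of_col hi h2, h3]⟩
  spacer_disjoint n l hl hne := by
    rw [A.heights_eq] at hl hne
    rw [A.iterate_level hl, Set.disjoint_left]
    intro x hx hx'
    simp only [towerUnion, mem_iUnion, Finset.mem_range, A.heights_eq] at hx'
    obtain ⟨k, hk, hx'⟩ := hx'
    rw [A.iterate_level hk] at hx'
    obtain ⟨j, hj, hc⟩ := hx'.2.1 n le_rfl
    refine hne j hj k hk ?_
    rw [← hx.2.2, A.pos_succ_of_col hj hc, hx'.2.2]

variable [∀ n, NeZero (Q n)]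

lemma towersGenerate : TowersGenerate (digitMeasure Q) A.T A.p fun n => A.level n 0 := by
  set m₀ := MeasurableSpace.generateFrom
    {s : Set (Digits Q) | ∃ n k, k < heights A.p n ∧ s = (⇑A.T)^[k] '' A.level n 0} with hm₀
  have hlev : ∀ n k, k < h n → MeasurableSet[m₀] (A.level n k) := by
    intro n k hk
    apply MeasurableSpace.measurableSet_generateFrom
    exact ⟨n, k, by rwa [A.heights_eq], (A.iterate_level hk).symm⟩
  have hle : MeasurableSpace.pi ≤ eventuallyMeasurableSpace m₀ (ae (digitMeasure Q)) := by
    refine A.generateFrom_cylinders.le.trans (MeasurableSpace.generateFrom_le ?_)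
    rintro _ ⟨n, S, hS, rfl⟩
    choose R hR e using fun N : ℕ => A.exists_cylinder_of_le (Nat.le_add_left n N) S
    refine ⟨⋃ N, ⋃ k ∈ R N, A.level (N + n) k, ?_, ?_⟩
    · refine MeasurableSet.iUnion fun N => Finset.measurableSet_biUnion _ fun k hk => ?_
      exact hlev _ _ (Finset.mem_range.1 (hR N hk))
    · filter_upwards [A.ae_mem_core] with x hx
      refine propext ?_
      change x ∈ {x | A.pos n x ∈ S} ↔ x ∈ ⋃ N, ⋃ k ∈ R N, A.level (N + n) k
      simp only [mem_iUnion, level, mem_ofPred_eq, exists_prop]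
      constructor
      · intro hxS
        obtain ⟨N, hN⟩ := A.mem_core.1 hx 0
        have h1 : x ∈ {x | A.pos n x ∈ S} := hxS
        rw [e N] at h1
        exact ⟨N, _, h1, hx, A.dom_mono (by omega) hN.1, rfl⟩
      · rintro ⟨N, k, hk, -, -, rfl⟩
        have h1 : x ∈ {x | A.pos (N + n) x ∈ R N} := hk
        rwa [← e N] at h1
  intro C hC
  obtain ⟨t, ht, hCt⟩ := hle C hC
  exact ⟨t, ht, measure_symmDiff_eq_zero_iff.2 hCt⟩

lemma isRankOneWith : IsRankOneWith (digitMeasure Q) A.T A.p :=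
  ⟨A.measurePreserving_T, A.condF, _, _, A.isCuttingStacking, A.towersGenerate⟩

include A in
lemma noAtoms_digitMeasure : NullSingletonClass (digitMeasure Q) where
  measure_singleton x := by
    have h1 : (digitMeasure Q).real {x} ≤ 0 := by
      refine ge_of_tendsto' (A.tendsto_div_h 1) fun n => ?_
      rw [← A.digitMeasure_pos_eq n (A.pos n x) (A.pos_lt n x)]
      exact measureReal_mono (by rintro y rfl; rfl)
    exact (measureReal_eq_zero_iff).1 (le_antisymm h1 measureReal_nonneg)

include A in
lemma standard_of_adic (T : Digits Q ≃ᵐ Digits Q) :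
    MSystem.Standard ⟨Digits Q, digitMeasure Q, T⟩ := by
  refine ⟨?_, ?_, ?_⟩
  · change StandardBorelSpace (Digits Q); infer_instance
  · change IsProbabilityMeasure (digitMeasure Q); infer_instance
  · exact A.noAtoms_digitMeasure

end Adic

namespace Adic

variable {Q h : ℕ → ℕ} (A S : Adic Q h)

/-- The points far enough from the ends of the `n`-th towers of both constructions. -/
def common (n : ℕ) : Set (Digits Q) := A.inner n 1 ∩ S.inner n 1

lemma measurableSet_common (n : ℕ) : MeasurableSet (A.common S n) :=
  (A.measurableSet_inner n 1).inter (S.measurableSet_inner n 1)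

lemma exists_mem_common {x : Digits Q} (hA : x ∈ A.core) (hS : x ∈ S.core) :
    ∃ n, x ∈ A.common S n := by
  obtain ⟨n, hn⟩ := A.mem_core.1 hA 1
  obtain ⟨m, hm⟩ := S.mem_core.1 hS 1
  exact ⟨max n m, A.inner_mono 1 (le_max_left n m) hn, S.inner_mono 1 (le_max_right n m) hm⟩

lemma zero_notMem_common (x : Digits Q) : x ∉ A.common S 0 := by
  rintro ⟨⟨-, h1, -⟩, -⟩
  simp at h1

lemma rel_T_of_mem_inner {n : ℕ} {x : Digits Q} (hc : x ∈ A.core) (hx : x ∈ A.inner n 1) :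
    A.Rel n 1 x (A.T x) := by
  have h1 := rel_repl (d := 1) (by simpa using hx)
  have h2 : A.T x = A.move 1 x := rfl
  rwa [h2, h1.move_eq hc]

open Classical in
/-- The first stage at which a point lies in `common`. -/
noncomputable def stage (x : Digits Q) : ℕ :=
  if hx : ∃ n, x ∈ A.common S n then Nat.find hx else 0

lemma stage_spec {x : Digits Q} (hx : ∃ n, x ∈ A.common S n) :
    x ∈ A.common S (A.stage S x) ∧ ∀ n < A.stage S x, x ∉ A.common S n := by
  classical
  rw [stage, dif_pos hx]
  exact ⟨Nat.find_spec hx, fun n hn => Nat.find_min hx hn⟩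

lemma measurable_stage : Measurable (A.stage S) := by
  classical
  refine Measurable.dite (s := {x | ∃ n, x ∈ A.common S n})
    (f := fun x => Nat.find x.2) (g := fun _ => 0) ?_ measurable_const ?_
  · exact measurable_find
      (p := fun (x : {x : Digits Q | ∃ n, x ∈ A.common S n}) n => x.1 ∈ A.common S n)
      (fun x => x.2) fun n => measurable_subtype_coe (A.measurableSet_common S n)
  · have : {x | ∃ n, x ∈ A.common S n} = ⋃ n, A.common S n := by ext; simp
    rw [this]
    exact MeasurableSet.iUnion (A.measurableSet_common S)

/-- The cocycle of the identity map as an orbit equivalence between two adic transformations. -/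
noncomputable def cocycle (x : Digits Q) : ℤ :=
  (S.pos (A.stage S x) (A.T x) : ℤ) - S.pos (A.stage S x) x

lemma measurable_cocycle : Measurable (A.cocycle S) := by
  have h1 : Measurable fun z : ℕ × Digits Q => ((S.pos z.1 z.2 : ℕ) : ℤ) :=
    measurable_from_prod_countable_right fun n =>
      (measurable_of_countable (fun k : ℕ => (k : ℤ))).comp (S.measurable_pos n)
  exact (h1.comp ((A.measurable_stage S).prodMk A.T.measurable)).sub
    (h1.comp ((A.measurable_stage S).prodMk measurable_id))

lemma rel_cocycle {x : Digits Q} (hA : x ∈ A.core) (hS : x ∈ S.core) :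
    S.Rel (A.stage S x) (A.cocycle S x) x (A.T x) := by
  have h1 := (A.stage_spec S (A.exists_mem_common S hA hS)).1
  exact ⟨h1.2.1, (A.rel_T_of_mem_inner hA h1.1).2.1, by unfold cocycle; ring⟩

lemma T_eq_zIter_cocycle {x : Digits Q} (hA : x ∈ A.core) (hS : x ∈ S.core) :
    A.T x = zIter S.T (A.cocycle S x) x := by
  rw [zIter_T, (A.rel_cocycle S hA hS).move_eq hS]

lemma natAbs_cocycle_le {n W : ℕ} {x : Digits Q} (hA : x ∈ A.core) (hS : x ∈ S.core)
    (hx : x ∈ A.common S n) (hn : A.stage S x ≤ n)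
    (hW : ∀ y : Digits Q, |(A.pos n y : ℤ) - S.pos n y| ≤ W) :
    (A.cocycle S x).natAbs ≤ 2 * W + 1 := by
  have h1 := ((A.rel_cocycle S hA hS).mono hn).2.2
  have h2 := (A.rel_T_of_mem_inner hA hx.1).2.2
  have h3 := abs_le.1 (hW x)
  have h4 := abs_le.1 (hW (A.T x))
  omega

variable [∀ n, NeZero (Q n)]

lemma integrable_cocycle {φ : ℝ → ℝ} (hφ0 : ∀ t : ℝ, 0 ≤ t → 0 ≤ φ t) {g : ℕ → ℝ}
    (hg : Monotone g) (hφg : ∀ k : ℕ, φ k ≤ g k) {W : ℕ → ℕ} {ε : ℕ → ℝ}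
    (hW : ∀ n (x : Digits Q), |(A.pos (n + 1) x : ℤ) - S.pos (n + 1) x| ≤ W n)
    (hA : ∀ n, A.tailRatio n + 2 / h n ≤ ε n) (hS : ∀ n, S.tailRatio n + 2 / h n ≤ ε n)
    (hsum : Summable fun n => g (2 * W n + 1) * ε n) :
    Integrable (fun x => φ |(A.cocycle S x : ℝ)|) (digitMeasure Q) := by
  have hg0 : ∀ k, 0 ≤ g k := fun k => (hφ0 k (Nat.cast_nonneg k)).trans (hφg k)
  have hε : ∀ n, 0 ≤ ε n := fun n =>
    (add_nonneg (A.tailRatio_nonneg n) (by positivity)).trans (hA n)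
  have hmeas : ∀ n, (digitMeasure Q).real (A.common S n)ᶜ ≤ 2 * ε n := by
    intro n
    rw [common, compl_inter]
    have h1 := A.digitMeasure_inner_compl n 1
    have h2 := S.digitMeasure_inner_compl n 1
    simp only [Nat.cast_one, mul_one] at h1 h2
    linarith [measureReal_union_le (μ := digitMeasure Q) (A.inner n 1)ᶜ (S.inner n 1)ᶜ, hA n, hS n]
  have hm : Measurable fun x => φ |(A.cocycle S x : ℝ)| :=
    (measurable_of_countable fun c : ℤ => φ |(c : ℝ)|).comp (A.measurable_cocycle S)
  refine ⟨hm.aestronglyMeasurable, ?_⟩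
  rw [hasFiniteIntegral_iff_ofReal (ae_of_all _ fun x => hφ0 _ (abs_nonneg _))]
  have hbound : ∀ᵐ x ∂digitMeasure Q, ENNReal.ofReal (φ |(A.cocycle S x : ℝ)|) ≤
      ∑' n, (A.common S n)ᶜ.indicator (fun _ => ENNReal.ofReal (g (2 * W n + 1))) x := by
    filter_upwards [A.ae_mem_core, S.ae_mem_core] with x hxA hxS
    obtain ⟨h1, h2⟩ := A.stage_spec S (A.exists_mem_common S hxA hxS)
    obtain ⟨n, hn⟩ : ∃ n, A.stage S x = n + 1 := by
      refine Nat.exists_eq_succ_of_ne_zero fun h0 => ?_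
      rw [h0] at h1
      exact A.zero_notMem_common S x h1
    refine le_trans ?_ (ENNReal.le_tsum n)
    rw [indicator_of_mem (h2 n (by omega))]
    apply ENNReal.ofReal_le_ofReal
    have h3 : |(A.cocycle S x : ℝ)| = ((A.cocycle S x).natAbs : ℕ) := by
      rw [Nat.cast_natAbs, Int.cast_abs]
    rw [h3]
    refine (hφg _).trans (hg ?_)
    rw [hn] at h1
    exact A.natAbs_cocycle_le S hxA hxS h1 hn.le (hW n)
  refine (lintegral_mono_ae hbound).trans_lt ?_
  rw [lintegral_tsum fun n => (measurable_const.indicator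
    (A.measurableSet_common S n).compl).aemeasurable]
  have hterm : ∀ n, ∫⁻ x, (A.common S n)ᶜ.indicator
      (fun _ => ENNReal.ofReal (g (2 * W n + 1))) x ∂digitMeasure Q ≤
      ENNReal.ofReal (2 * (g (2 * W n + 1) * ε n)) := by
    intro n
    rw [lintegral_indicator_const (A.measurableSet_common S n).compl, ← ofReal_measureReal,
      ← ENNReal.ofReal_mul (hg0 _)]
    apply ENNReal.ofReal_le_ofReal
    nlinarith [mul_le_mul_of_nonneg_left (hmeas n) (hg0 (2 * W n + 1))]
  refine (ENNReal.tsum_le_tsum hterm).trans_lt ?_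
  rw [← ENNReal.ofReal_tsum_of_nonneg
    (fun n => mul_nonneg zero_le_two (mul_nonneg (hg0 _) (hε n))) (hsum.mul_left 2)]
  exact ENNReal.ofReal_lt_top

lemma phiIntegrablyOE {φ : ℝ → ℝ} (hφ0 : ∀ t : ℝ, 0 ≤ t → 0 ≤ φ t) {g : ℕ → ℝ}
    (hg : Monotone g) (hφg : ∀ k : ℕ, φ k ≤ g k) {W : ℕ → ℕ} {ε : ℕ → ℝ}
    (hW : ∀ n (x : Digits Q), |(A.pos (n + 1) x : ℤ) - S.pos (n + 1) x| ≤ W n)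
    (hA : ∀ n, A.tailRatio n + 2 / h n ≤ ε n) (hS : ∀ n, S.tailRatio n + 2 / h n ≤ ε n)
    (hsum : Summable fun n => g (2 * W n + 1) * ε n) :
    PhiIntegrablyOE (digitMeasure Q) A.T (digitMeasure Q) S.T φ := by
  refine ⟨MeasurableEquiv.refl _, MeasurePreserving.id _, ?_, A.cocycle S, S.cocycle A,
    A.measurable_cocycle S, S.measurable_cocycle A, ?_, ?_,
    A.integrable_cocycle S hφ0 hg hφg hW hA hS hsum,
    S.integrable_cocycle A hφ0 hg hφg (fun n x => by rw [abs_sub_comm]; exact hW n x) hS hA hsum⟩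
  · filter_upwards [A.ae_mem_core, S.ae_mem_core] with x hA hS
    simp [A.orbit_T hA, S.orbit_T hS]
  · filter_upwards [A.ae_mem_core, S.ae_mem_core] with x hA hS
    exact A.T_eq_zIter_cocycle S hA hS
  · filter_upwards [A.ae_mem_core, S.ae_mem_core] with x hA hS
    exact S.T_eq_zIter_cocycle A hS hA

end Adic

section Equidistribution

/-- Extension of a finite word to an infinite one. -/
def extendWord {a q : ℕ} [NeZero a] (ω : Fin q → Fin a) (i : ℕ) : Fin a :=
  if hi : i < q then ω ⟨i, hi⟩ else 0

lemma extendWord_update_of_ne {a q : ℕ} [NeZero a] (ω : Fin q → Fin a) (m : Fin q) (v : Fin a)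
    {i : ℕ} (hi : i ≠ m) : extendWord (Function.update ω m v) i = extendWord ω i := by
  unfold extendWord
  split_ifs with h1
  · rw [Function.update_of_ne]
    exact fun h2 => hi (by rw [← h2])
  · rfl

lemma extendWord_update_self {a q : ℕ} [NeZero a] (ω : Fin q → Fin a) (m : Fin q) (v : Fin a) :
    extendWord (Function.update ω m v) m = v := by
  simp [extendWord]

lemma sum_sum_update {ι κ : Type*} [Fintype ι] [DecidableEq ι] [Fintype κ]
    (G : (ι → κ) → ℝ) (m : ι) :
    ∑ ω, ∑ v, G (Function.update ω m v) = Fintype.card κ * ∑ ω, G ω := by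
  let e : (ι → κ) × κ → (ι → κ) × κ := fun z => (Function.update z.1 m z.2, z.1 m)
  have he : Function.Involutive e := by
    rintro ⟨ω, v⟩
    simp [e]
  have h1 := Equiv.sum_comp he.toPerm fun z : (ι → κ) × κ => G z.1
  rw [Fintype.sum_prod_type, Fintype.sum_prod_type] at h1
  simp only [Function.Involutive.coe_toPerm, e] at h1
  rw [h1]
  simp [Finset.mul_sum]

lemma sum_exp_le {a : ℕ} (f : Fin a → ℝ) (hf : ∀ v, |f v| ≤ 1) (hf0 : ∑ v, f v = 0) {t : ℝ}
    (ht : |t| ≤ 1) : ∑ v, Real.exp (t * f v) ≤ a * (1 + t ^ 2) := by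
  have h1 : ∀ v, Real.exp (t * f v) ≤ 1 + t * f v + t ^ 2 := by
    intro v
    have h2 : |t * f v| ≤ 1 := by
      rw [abs_mul]; exact mul_le_one₀ ht (abs_nonneg _) (hf v)
    have h3 := (abs_le.1 (Real.abs_exp_sub_one_sub_id_le h2)).2
    have h4 : (t * f v) ^ 2 ≤ t ^ 2 := by
      rw [mul_pow]
      exact mul_le_of_le_one_right (sq_nonneg t) ((sq_le_one_iff_abs_le_one _).2 (hf v))
    linarith
  refine (Finset.sum_le_sum fun v _ => h1 v).trans (le_of_eq ?_)
  rw [Finset.sum_add_distrib, Finset.sum_add_distrib, ← Finset.mul_sum, hf0]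
  simp
  ring

variable {a : ℕ} [NeZero a]

lemma sum_exp_birkhoff_le (f : Fin a → Fin a → ℝ) (hf : ∀ u v, |f u v| ≤ 1)
    (hf0 : ∀ u, ∑ v, f u v = 0) {t : ℝ} (ht : |t| ≤ 1) {q l : ℕ} (hl : 1 ≤ l) (N : ℕ)
    (hN : N + l ≤ q) :
    ∑ ω : Fin q → Fin a, Real.exp (t * ∑ i ∈ Finset.range N,
      f (extendWord ω i) (extendWord ω (i + l))) ≤ (a : ℝ) ^ q * (1 + t ^ 2) ^ N := by
  induction N with
  | zero => simp
  | succ N ih =>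
    have ha : (0 : ℝ) < a := by exact_mod_cast Nat.pos_of_ne_zero (NeZero.ne a)
    have ih := ih (by omega)
    have h1 := sum_sum_update (fun ω : Fin q → Fin a => Real.exp (t * ∑ i ∈ Finset.range (N + 1),
      f (extendWord ω i) (extendWord ω (i + l)))) ⟨N + l, by omega⟩
    have h2 : ∀ ω : Fin q → Fin a, ∑ v, Real.exp (t * ∑ i ∈ Finset.range (N + 1),
        f (extendWord (Function.update ω ⟨N + l, by omega⟩ v) i)
          (extendWord (Function.update ω ⟨N + l, by omega⟩ v) (i + l))) =
        Real.exp (t * ∑ i ∈ Finset.range N, f (extendWord ω i) (extendWord ω (i + l))) *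
          ∑ v, Real.exp (t * f (extendWord ω N) v) := by
      intro ω
      rw [Finset.mul_sum]
      refine Finset.sum_congr rfl fun v _ => ?_
      rw [← Real.exp_add, ← mul_add, Finset.sum_range_succ]
      congr 3
      · refine Finset.sum_congr rfl fun i hi => ?_
        have hi := Finset.mem_range.1 hi
        rw [extendWord_update_of_ne, extendWord_update_of_ne] <;> simp <;> omega
      · rw [extendWord_update_of_ne _ _ _ (by simp; omega)]
        congr 1
        exact extendWord_update_self ω ⟨N + l, by omega⟩ v
    rw [Finset.sum_congr rfl fun ω _ => h2 ω, Fintype.card_fin] at h1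
    have h3 := Finset.sum_le_sum fun (ω : Fin q → Fin a) (_ : ω ∈ Finset.univ) =>
      mul_le_mul_of_nonneg_left (sum_exp_le (f (extendWord ω N)) (hf _) (hf0 _) ht)
        (Real.exp_pos (t * ∑ i ∈ Finset.range N,
          f (extendWord ω i) (extendWord ω (i + l)))).le
    rw [h1, ← Finset.sum_mul] at h3
    have h4 := mul_le_mul_of_nonneg_right ih (by positivity : 0 ≤ (a : ℝ) * (1 + t ^ 2))
    have h5 := h3.trans h4
    have h6 : (a : ℝ) ^ q * (1 + t ^ 2) ^ N * (a * (1 + t ^ 2)) =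
        a * (a ^ q * (1 + t ^ 2) ^ (N + 1)) := by ring
    rw [h6] at h5
    exact le_of_mul_le_mul_left h5 ha

lemma card_large_birkhoff_le (f : Fin a → Fin a → ℝ) (hf : ∀ u v, |f u v| ≤ 1)
    (hf0 : ∀ u, ∑ v, f u v = 0) {η : ℝ} (hη : 0 < η) (hη1 : η ≤ 1) {q l : ℕ} (hl : 1 ≤ l)
    {N : ℕ} (hN : N + l ≤ q) :
    ((Finset.univ.filter fun ω : Fin q → Fin a => η * q < ∑ i ∈ Finset.range N,
      f (extendWord ω i) (extendWord ω (i + l))).card : ℝ) ≤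
        (a : ℝ) ^ q * Real.exp (-(η ^ 2 / 4) * q) := by
  have ht : |η / 2| ≤ 1 := by rw [abs_of_pos (by linarith)]; linarith
  have h1 := sum_exp_birkhoff_le f hf hf0 ht hl N hN
  have h2 : (1 + (η / 2) ^ 2) ^ N ≤ Real.exp ((η / 2) ^ 2 * q) := by
    calc (1 + (η / 2) ^ 2) ^ N ≤ (1 + (η / 2) ^ 2) ^ q :=
          pow_le_pow_right₀ (by nlinarith) (by omega)
      _ ≤ Real.exp ((η / 2) ^ 2) ^ q := by
          gcongr
          linarith [Real.add_one_le_exp ((η / 2) ^ 2)]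
      _ = _ := by rw [← Real.exp_nat_mul, mul_comm]
  have h3 := h1.trans (mul_le_mul_of_nonneg_left h2 (by positivity))
  have h4 : ((Finset.univ.filter fun ω : Fin q → Fin a => η * q < ∑ i ∈ Finset.range N,
      f (extendWord ω i) (extendWord ω (i + l))).card : ℝ) * Real.exp (η / 2 * (η * q)) ≤
      ∑ ω : Fin q → Fin a, Real.exp (η / 2 * ∑ i ∈ Finset.range N,
      f (extendWord ω i) (extendWord ω (i + l))) := by
    rw [← nsmul_eq_mul, ← Finset.sum_const]
    refine (Finset.sum_le_sum fun ω hω => ?_).trans (Finset.sum_le_sum_of_subset_of_nonneg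
      (Finset.filter_subset _ _) fun ω _ _ => (Real.exp_pos _).le)
    apply Real.exp_le_exp.2
    exact mul_le_mul_of_nonneg_left (Finset.mem_filter.1 hω).2.le (by linarith)
  have h5 := h4.trans h3
  rw [← le_div_iff₀ (Real.exp_pos _), mul_div_assoc, ← Real.exp_sub] at h5
  refine h5.trans (le_of_eq ?_)
  congr 2
  ring

lemma eventually_exists_birkhoff_le {ι : Type*} [Fintype ι] (f : ι → Fin a → Fin a → ℝ)
    (hf : ∀ j u v, |f j u v| ≤ 1) (hf0 : ∀ j u, ∑ v, f j u v = 0) {η : ℝ} (hη : 0 < η)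
    (hη1 : η ≤ 1) :
    ∀ᶠ q : ℕ in atTop, ∃ b : ℕ → Fin a, ∀ j l N, 1 ≤ l → N + l ≤ q →
      ∑ i ∈ Finset.range N, f j (b i) (b (i + l)) ≤ η * q := by
  classical
  have hlim : Tendsto (fun q : ℕ => (Fintype.card ι : ℝ) * (((q : ℝ) + 1) ^ 2 *
      Real.exp (-(η ^ 2 / 4) * q))) atTop (𝓝 0) := by
    have h1 : ∀ k : ℕ, Tendsto (fun q : ℕ => (q : ℝ) ^ k * Real.exp (-(η ^ 2 / 4) * q)) atTop
        (𝓝 0) := fun k => by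
      have := tendsto_rpow_mul_exp_neg_mul_atTop_nhds_zero (k : ℝ) (η ^ 2 / 4) (by positivity)
      simpa [Function.comp_def] using this.comp tendsto_natCast_atTop_atTop
    have h2 := (((h1 2).add ((h1 1).const_mul 2)).add (h1 0)).const_mul (Fintype.card ι : ℝ)
    simp only [mul_zero, add_zero] at h2
    refine h2.congr fun q => ?_
    ring
  filter_upwards [hlim.eventually_lt_const one_pos] with q hq
  have ha : (0 : ℝ) < a := by exact_mod_cast Nat.pos_of_ne_zero (NeZero.ne a)
  let bad : ι × ℕ × ℕ → Finset (Fin q → Fin a) := fun z =>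
    if 1 ≤ z.2.1 ∧ z.2.2 + z.2.1 ≤ q then
      Finset.univ.filter fun ω : Fin q → Fin a => η * q < ∑ i ∈ Finset.range z.2.2,
        f z.1 (extendWord ω i) (extendWord ω (i + z.2.1))
    else ∅
  let idx : Finset (ι × ℕ × ℕ) := Finset.univ ×ˢ Finset.range (q + 1) ×ˢ Finset.range (q + 1)
  have hcard : ((idx.biUnion bad).card : ℝ) < (a : ℝ) ^ q := by
    have h1 : ((idx.biUnion bad).card : ℝ) ≤ ∑ z ∈ idx, ((bad z).card : ℝ) := by
      exact_mod_cast Finset.card_biUnion_le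
    have h2 : ∀ z ∈ idx, ((bad z).card : ℝ) ≤ (a : ℝ) ^ q * Real.exp (-(η ^ 2 / 4) * q) := by
      intro z _
      by_cases hz : 1 ≤ z.2.1 ∧ z.2.2 + z.2.1 ≤ q
      · simp only [bad, if_pos hz]
        exact card_large_birkhoff_le (f z.1) (hf _) (hf0 _) hη hη1 hz.1 hz.2
      · simp only [bad, if_neg hz, Finset.card_empty, Nat.cast_zero]
        positivity
    have h3 := h1.trans (Finset.sum_le_sum h2)
    rw [Finset.sum_const, nsmul_eq_mul] at h3
    simp only [idx, Finset.card_product, Finset.card_univ, Finset.card_range] at h3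
    push_cast at h3
    refine h3.trans_lt ?_
    have h4 := mul_lt_mul_of_pos_right hq (pow_pos ha q)
    rw [one_mul] at h4
    refine lt_of_eq_of_lt ?_ h4
    ring
  obtain ⟨ω, hω⟩ : ∃ ω, ω ∉ idx.biUnion bad := by
    by_contra! hall
    have h1 : idx.biUnion bad = Finset.univ := Finset.eq_univ_iff_forall.2 hall
    rw [h1] at hcard
    simp at hcard
  refine ⟨extendWord ω, fun j l N hl hN => ?_⟩
  by_contra! hlt
  refine hω (Finset.mem_biUnion.2 ⟨(j, l, N), ?_, ?_⟩)
  · simp only [idx, Finset.mem_product, Finset.mem_univ, Finset.mem_range, true_and]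
    omega
  · simp only [bad, if_pos (show 1 ≤ l ∧ N + l ≤ q from ⟨hl, hN⟩)]
    simpa using hlt

lemma eventually_exists_abs_birkhoff_le {ι : Type*} [Fintype ι] (f : ι → Fin a → Fin a → ℝ)
    (hf : ∀ j u v, |f j u v| ≤ 1) (hf0 : ∀ j u, ∑ v, f j u v = 0) {η : ℝ} (hη : 0 < η)
    (hη1 : η ≤ 1) :
    ∀ᶠ q : ℕ in atTop, ∃ b : ℕ → Fin a, ∀ j l N, 1 ≤ l → N + l ≤ q →
      |∑ i ∈ Finset.range N, f j (b i) (b (i + l))| ≤ η * q := by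
  filter_upwards [eventually_exists_birkhoff_le (Sum.elim f fun j u v => -f j u v)
    (by rintro (j | j) u v <;> simp [hf]) (by rintro (j | j) u <;> simp [hf0]) hη hη1]
    with q ⟨b, hb⟩
  refine ⟨b, fun j l N hl hN => abs_le.2 ⟨?_, hb (Sum.inl j) l N hl hN⟩⟩
  have := hb (Sum.inr j) l N hl hN
  simp only [Sum.elim_inr, Finset.sum_neg_distrib] at this
  linarith

/-- The word `b` has, up to an error `η` and for all gaps, uniformly distributed pairs of
letters, when averaged against `0`-`1`-valued functions. -/
def Equidistributed (a q : ℕ) (b : ℕ → ℕ) (η : ℝ) : Prop :=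
  ∀ P : ℕ → ℕ → Prop, ∀ [∀ u v, Decidable (P u v)], ∀ l N, 1 ≤ l → N + l ≤ q →
    |∑ i ∈ Finset.range N, ((if P (b i) (b (i + l)) then (1 : ℝ) else 0) -
      (((Finset.range a).filter fun v => P (b i) v).card : ℝ) / a)| ≤ η * q

lemma eventually_exists_equidistributed (a : ℕ) (ha : 0 < a) {η : ℝ} (hη : 0 < η)
    (hη1 : η ≤ 1) :
    ∀ᶠ q : ℕ in atTop, ∃ b : ℕ → ℕ, (∀ i, b i < a) ∧ Equidistributed a q b η := by
  classical
  have : NeZero a := ⟨ha.ne'⟩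
  have ha' : (0 : ℝ) < a := by exact_mod_cast ha
  let f : (Fin a → Fin a → Bool) → Fin a → Fin a → ℝ := fun P u v =>
    (if P u v then (1 : ℝ) else 0) - (∑ w, if P u w then (1 : ℝ) else 0) / a
  have hf : ∀ P u v, |f P u v| ≤ 1 := by
    intro P u v
    have h0 : 0 ≤ ∑ w, if P u w then (1 : ℝ) else 0 :=
      Finset.sum_nonneg fun w _ => by split_ifs <;> norm_num
    have h1 : (∑ w, if P u w then (1 : ℝ) else 0) ≤ a := by
      refine (Finset.sum_le_sum (g := fun _ => (1 : ℝ)) fun w _ => ?_).trans (by simp)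
      split_ifs <;> norm_num
    have h2 : (∑ w, if P u w then (1 : ℝ) else 0) / a ≤ 1 := (div_le_one ha').2 h1
    have h3 : 0 ≤ (∑ w, if P u w then (1 : ℝ) else 0) / a := by positivity
    simp only [f]
    rw [abs_le]
    split_ifs <;> constructor <;> linarith
  have hf0 : ∀ P u, ∑ v, f P u v = 0 := by
    intro P u
    simp only [f]
    rw [Finset.sum_sub_distrib, Finset.sum_const, Finset.card_univ, Fintype.card_fin,
      nsmul_eq_mul, mul_div_cancel₀ _ ha'.ne', sub_self]
  filter_upwards [eventually_exists_abs_birkhoff_le f hf hf0 hη hη1] with q ⟨b, hb⟩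
  refine ⟨fun i => b i, fun i => (b i).2, fun P _ l N hl hN => ?_⟩
  refine le_trans (le_of_eq ?_) (hb (fun u v => decide (P u v)) l N hl hN)
  congr 1
  refine Finset.sum_congr rfl fun i _ => ?_
  simp only [f, decide_eq_true_eq]
  congr 2
  rw [Finset.card_filter, Nat.cast_sum, ← Fin.sum_univ_eq_sum_range
    (fun v => ((if P (b i) v then 1 else 0 : ℕ) : ℝ))]
  simp

end Equidistribution

/-- The parameters of the construction: `h n` is the height of the `n`-th tower, `a n` the width
of the window in which each of the `h n * K n` copies of this tower is displaced, and `b n i` the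
displacement of the `i`-th copy. -/
structure Scheme where
  h : ℕ → ℕ
  a : ℕ → ℕ
  K : ℕ → ℕ
  b : ℕ → ℕ → ℕ
  h_zero : h 0 = 1
  h_succ : ∀ n, h (n + 1) = h n * (K n * (h n + a n))
  a_zero : a 0 = 1
  a_succ : ∀ n, a (n + 1) = (n + 2) * (h n + a n)
  b_lt : ∀ n i, b n i < a n
  two_le_K : ∀ n, 2 ≤ K n
  dvd_K : ∀ n, n + 1 ∣ K n
  growth : ∀ n, ((a (n + 1) + 2) * 2 ^ (n + 1)) ^ 3 ≤ h (n + 1)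
  equi : ∀ n, Equidistributed (a n) (h n * K n) (b n) (1 / (n + 1))

lemma exists_scheme_step (n h a : ℕ) (hh : 0 < h) (ha : 0 < a) :
    ∃ K : ℕ, ∃ b : ℕ → ℕ, (∀ i, b i < a) ∧ 2 ≤ K ∧ n + 1 ∣ K ∧
      (((n + 2) * (h + a) + 2) * 2 ^ (n + 1)) ^ 3 ≤ h * (K * (h + a)) ∧
      Equidistributed a (h * K) b (1 / (n + 1)) := by
  have h1 := eventually_exists_equidistributed a ha (η := 1 / (n + 1)) (by positivity)
    ((div_le_one (by positivity)).2 (by norm_cast; omega))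
  obtain ⟨q₀, hq₀⟩ := eventually_atTop.1 h1
  set G := (((n + 2) * (h + a) + 2) * 2 ^ (n + 1)) ^ 3
  set m := q₀ + G + 2
  have hm : m ≤ (n + 1) * m := Nat.le_mul_of_pos_left _ (by omega)
  have hm' : (n + 1) * m ≤ h * ((n + 1) * m) := Nat.le_mul_of_pos_left _ hh
  have hm'' : h * ((n + 1) * m) ≤ h * ((n + 1) * m * (h + a)) :=
    Nat.mul_le_mul_left _ (Nat.le_mul_of_pos_right _ (by omega))
  obtain ⟨b, hb, hE⟩ := hq₀ (h * ((n + 1) * m)) (by omega)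
  exact ⟨(n + 1) * m, b, hb, by omega, ⟨m, rfl⟩, by omega, hE⟩

lemma exists_scheme : Nonempty Scheme := by
  have h1 : ∀ n h a : ℕ, ∃ K : ℕ, ∃ b : ℕ → ℕ, 0 < h → 0 < a → (∀ i, b i < a) ∧ 2 ≤ K ∧
      n + 1 ∣ K ∧ (((n + 2) * (h + a) + 2) * 2 ^ (n + 1)) ^ 3 ≤ h * (K * (h + a)) ∧
      Equidistributed a (h * K) b (1 / (n + 1)) := by
    intro n h a
    by_cases hh : 0 < h ∧ 0 < a
    · obtain ⟨K, b, hK⟩ := exists_scheme_step n h a hh.1 hh.2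
      exact ⟨K, b, fun _ _ => hK⟩
    · exact ⟨0, 0, fun h2 h3 => absurd ⟨h2, h3⟩ hh⟩
  choose K b hKb using h1
  let st : ℕ → ℕ × ℕ := fun n => Nat.rec (1, 1)
    (fun n s => (s.1 * (K n s.1 s.2 * (s.1 + s.2)), (n + 2) * (s.1 + s.2))) n
  have hpos : ∀ n, 0 < (st n).1 ∧ 0 < (st n).2 := by
    intro n
    induction n with
    | zero => exact ⟨one_pos, one_pos⟩
    | succ n ih =>
      have h2 := (hKb n _ _ ih.1 ih.2).2.1
      have h3 : 0 < (st n).1 + (st n).2 := by omega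
      exact ⟨Nat.mul_pos ih.1 (Nat.mul_pos (two_pos.trans_le h2) h3), Nat.mul_pos (Nat.succ_pos _) h3⟩
  have hs := fun n => hKb n _ _ (hpos n).1 (hpos n).2
  exact ⟨{
    h := fun n => (st n).1
    a := fun n => (st n).2
    K := fun n => K n (st n).1 (st n).2
    b := fun n => b n (st n).1 (st n).2
    h_zero := rfl
    h_succ := fun _ => rfl
    a_zero := rfl
    a_succ := fun _ => rfl
    b_lt := fun n => (hs n).1
    two_le_K := fun n => (hs n).2.1
    dvd_K := fun n => (hs n).2.2.1
    growth := fun n => (hs n).2.2.2.1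
    equi := fun n => (hs n).2.2.2.2 }⟩

lemma eq_and_eq_of_mul_add_eq {H j o j' o' : ℕ} (ho : o < H) (ho' : o' < H)
    (he : j * H + o = j' * H + o') : j = j' ∧ o = o' := by
  have h1 : j = j' := by
    have := congrArg (· / H) he
    simpa [Nat.add_div_of_dvd_right, Nat.mul_add_div, mul_comm _ H, Nat.div_eq_of_lt, ho, ho',
      Nat.pos_of_ne_zero (show H ≠ 0 by omega)] using this
  subst h1
  exact ⟨rfl, by omega⟩

lemma mul_add_lt_mul {H j o q : ℕ} (hj : j < q) (ho : o < H) : j * H + o < q * H := by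
  have : (j + 1) * H ≤ q * H := Nat.mul_le_mul_right H hj
  rw [add_mul] at this
  omega

namespace Scheme

variable (s : Scheme)

/-- The number of copies of the `n`-th tower in the next one. -/
def q (n : ℕ) : ℕ := s.h n * s.K n

/-- The average distance between the successive copies of the `n`-th tower. -/
def H (n : ℕ) : ℕ := s.h n + s.a n

/-- The number of values of the `n`-th digit. -/
def Q (n : ℕ) : ℕ := s.K n * s.H n

lemma h_succ' (n : ℕ) : s.h (n + 1) = s.q n * s.H n := by
  rw [s.h_succ, q, H, mul_assoc]

lemma h_pos (n : ℕ) : 0 < s.h n := by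
  induction n with
  | zero => simp [s.h_zero]
  | succ n ih =>
    rw [s.h_succ]
    have := s.two_le_K n
    positivity

lemma a_pos (n : ℕ) : 0 < s.a n := (Nat.zero_le _).trans_lt (s.b_lt n 0)

lemma H_pos (n : ℕ) : 0 < s.H n := Nat.add_pos_left (s.h_pos n) _

lemma two_le_q (n : ℕ) : 2 ≤ s.q n :=
  (s.two_le_K n).trans (Nat.le_mul_of_pos_left _ (s.h_pos n))

lemma two_le_Q (n : ℕ) : 2 ≤ s.Q n :=
  (s.two_le_K n).trans (Nat.le_mul_of_pos_right _ (s.H_pos n))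

instance (n : ℕ) : NeZero (s.Q n) := ⟨by have := s.two_le_Q n; omega⟩

lemma growth_le (n : ℕ) : s.a n * 2 ^ n ≤ s.h n := by
  cases n with
  | zero => simp [s.a_zero, s.h_zero]
  | succ n =>
    have h1 := Nat.le_self_pow (n := 3) (by norm_num) ((s.a (n + 1) + 2) * 2 ^ (n + 1))
    have h2 : s.a (n + 1) * 2 ^ (n + 1) ≤ (s.a (n + 1) + 2) * 2 ^ (n + 1) :=
      Nat.mul_le_mul_right _ (by omega)
    exact h2.trans (h1.trans (s.growth n))

lemma a_le_h (n : ℕ) : s.a n ≤ s.h n :=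
  (Nat.le_mul_of_pos_right _ (by positivity)).trans (s.growth_le n)

lemma a_div_h_le (n : ℕ) : (s.a n : ℝ) / s.h n ≤ (1 / 2) ^ n := by
  have h1 : (0 : ℝ) < s.h n := by exact_mod_cast s.h_pos n
  have h2 : (s.a n : ℝ) * 2 ^ n ≤ s.h n := by exact_mod_cast s.growth_le n
  rw [one_div_pow, div_le_div_iff₀ h1 (by positivity)]
  linarith

/-- The spacing parameters of the mixing construction. -/
def spacer (n i : ℕ) : ℕ :=
  if i = 0 then s.b n 0 else if i < s.q n then s.a n - s.b n (i - 1) + s.b n i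
  else if i = s.q n then s.a n - s.b n (i - 1) else 0

/-- The cutting and spacing parameters of the mixing construction. -/
def csMix (n : ℕ) : CSParam where
  q := s.q n
  two_le_q := s.two_le_q n
  σ := s.spacer n
  σ_eq_zero_of_gt i hi := by
    have : i ≠ 0 := by omega
    simp [spacer, this, hi.ne', hi.not_gt]

lemma sum_spacer (n i : ℕ) (hi : i < s.q n) :
    ∑ j ∈ Finset.range (i + 1), s.spacer n j = i * s.a n + s.b n i := by
  induction i with
  | zero => simp [spacer]
  | succ i ih =>
    rw [Finset.sum_range_succ, ih (by omega)]
    have := s.b_lt n i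
    simp only [spacer, Nat.add_one_ne_zero, if_false, if_pos hi, Nat.add_sub_cancel]
    rw [add_mul]
    omega

lemma σtot_csMix (n : ℕ) : (s.csMix n).σtot = s.q n * s.a n := by
  have hq := s.two_le_q n
  obtain ⟨i, hi⟩ : ∃ i, s.q n = i + 1 := ⟨s.q n - 1, by omega⟩
  have h1 := s.sum_spacer n i (by omega)
  have h2 := s.b_lt n i
  change ∑ j ∈ Finset.range (s.q n + 1), s.spacer n j = _
  rw [Finset.sum_range_succ, hi, h1]
  simp only [spacer, Nat.add_one_ne_zero, if_false, hi, lt_irrefl, if_true, Nat.add_sub_cancel]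
  rw [add_mul]
  omega

lemma heights_csMix (n : ℕ) : heights s.csMix n = s.h n := by
  induction n with
  | zero => simp [heights, s.h_zero]
  | succ n ih =>
    rw [heights, ih, σtot_csMix, h_succ', H, mul_add]
    rfl

lemma colStart_csMix (n i : ℕ) (hi : i < s.q n) :
    colStart s.csMix n i = i * s.H n + s.b n i := by
  have h1 := s.sum_spacer n i hi
  change ∑ j ∈ Finset.range (i + 1), s.spacer n j + i * heights s.csMix n = _
  rw [h1, heights_csMix, H, mul_add]
  ring

/-- The position map of the mixing construction. The digits come in `K n` blocks of length `H n`;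
in each block the first `h n` digits encode copies of the tower, and the other ones spacers. -/
def mixF (n t i : ℕ) : ℕ :=
  if i % s.H n < s.h n then
    (i / s.H n * s.h n + i % s.H n) * s.H n +
      (s.b n (i / s.H n * s.h n + i % s.H n) + t)
  else
    (i / s.H n * s.h n + t) * s.H n +
      if i % s.H n - s.h n < s.b n (i / s.H n * s.h n + t) then i % s.H n - s.h n else i % s.H n

/-- The slot of the next tower containing the position `mixF n t i`. -/
def slot (n t i : ℕ) : ℕ := i / s.H n * s.h n + if i % s.H n < s.h n then i % s.H n else t

/-- The offset of the position `mixF n t i` in its slot. -/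
def offset (n t i : ℕ) : ℕ :=
  if i % s.H n < s.h n then s.b n (s.slot n t i) + t
  else if i % s.H n - s.h n < s.b n (s.slot n t i) then i % s.H n - s.h n else i % s.H n

lemma mixF_eq (n t i : ℕ) : s.mixF n t i = s.slot n t i * s.H n + s.offset n t i := by
  unfold mixF offset slot
  split_ifs <;> rfl

lemma offset_lt {n t : ℕ} (i : ℕ) (ht : t < s.h n) : s.offset n t i < s.H n := by
  have h1 := s.b_lt n (s.slot n t i)
  have h2 := Nat.mod_lt i (s.H_pos n)
  unfold offset
  split_ifs
  · unfold H; omega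
  · omega
  · exact h2

lemma exists_slot {n t : ℕ} (i : ℕ) (ht : t < s.h n) :
    ∃ r < s.h n, s.slot n t i = i / s.H n * s.h n + r := by
  unfold slot
  split_ifs with h1
  · exact ⟨_, h1, rfl⟩
  · exact ⟨_, ht, rfl⟩

lemma div_H_lt {n i : ℕ} (hi : i < s.Q n) : i / s.H n < s.K n :=
  (Nat.div_lt_iff_lt_mul (s.H_pos n)).2 hi

lemma slot_lt {n t i : ℕ} (ht : t < s.h n) (hi : i < s.Q n) : s.slot n t i < s.q n := by
  obtain ⟨r, hr, e⟩ := s.exists_slot i ht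
  rw [e, q, mul_comm (s.h n)]
  exact mul_add_lt_mul (s.div_H_lt hi) hr

lemma mixF_lt {n t i : ℕ} (ht : t < s.h n) (hi : i < s.Q n) : s.mixF n t i < s.h (n + 1) := by
  rw [mixF_eq, h_succ']
  exact mul_add_lt_mul (s.slot_lt ht hi) (s.offset_lt i ht)

lemma mixF_inj {n t i t' i' : ℕ} (ht : t < s.h n) (ht' : t' < s.h n)
    (he : s.mixF n t i = s.mixF n t' i') : t = t' ∧ i = i' := by
  rw [mixF_eq, mixF_eq] at he
  obtain ⟨h1, h2⟩ := eq_and_eq_of_mul_add_eq (s.offset_lt i ht) (s.offset_lt i' ht') he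
  unfold offset at h2
  rw [← h1] at h2
  set β := s.b n (s.slot n t i)
  have hβ : β < s.a n := s.b_lt n _
  have e := Nat.div_add_mod i (s.H n)
  have e' := Nat.div_add_mod i' (s.H n)
  have l := Nat.mod_lt i (s.H_pos n)
  have l' := Nat.mod_lt i' (s.H_pos n)
  have hH : s.H n = s.h n + s.a n := rfl
  unfold slot at h1
  by_cases c : i % s.H n < s.h n <;> by_cases c' : i' % s.H n < s.h n
  · rw [if_pos c, if_pos c'] at h1 h2
    obtain ⟨h3, h4⟩ := eq_and_eq_of_mul_add_eq c c' h1
    rw [h3, h4] at e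
    exact ⟨by omega, by omega⟩
  · rw [if_pos c, if_neg c'] at h2
    split_ifs at h2 <;> omega
  · rw [if_neg c, if_pos c'] at h2
    split_ifs at h2 <;> omega
  · rw [if_neg c, if_neg c'] at h1 h2
    obtain ⟨h3, h4⟩ := eq_and_eq_of_mul_add_eq ht ht' h1
    have h5 : i % s.H n = i' % s.H n := by split_ifs at h2 <;> omega
    rw [h3, h5] at e
    exact ⟨h4, by omega⟩

/-- The digit encoding the `j`-th copy of the `n`-th tower. -/
def mixCol (n j : ℕ) : ℕ := j / s.h n * s.H n + j % s.h n

lemma mod_h_lt_H (n j : ℕ) : j % s.h n < s.H n :=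
  (Nat.mod_lt j (s.h_pos n)).trans_le (Nat.le_add_right _ _)

lemma mixCol_lt {n j : ℕ} (hj : j < s.q n) : s.mixCol n j < s.Q n := by
  refine mul_add_lt_mul ?_ (s.mod_h_lt_H n j)
  rw [Nat.div_lt_iff_lt_mul (s.h_pos n), mul_comm]
  exact hj

lemma mixF_mixCol (n j t : ℕ) : s.mixF n t (s.mixCol n j) = j * s.H n + s.b n j + t := by
  have h1 : s.mixCol n j % s.H n = j % s.h n := by
    rw [mixCol, mul_comm, Nat.mul_add_mod, Nat.mod_eq_of_lt (s.mod_h_lt_H n j)]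
  have h2 : s.mixCol n j / s.H n = j / s.h n := by
    rw [mixCol, mul_comm, Nat.mul_add_div (s.H_pos n), Nat.div_eq_of_lt (s.mod_h_lt_H n j),
      add_zero]
  have h3 : j / s.h n * s.h n + j % s.h n = j := by rw [mul_comm]; exact Nat.div_add_mod j _
  rw [mixF, h1, h2, if_pos (Nat.mod_lt j (s.h_pos n)), h3, add_assoc]

lemma spacer_ratio_le (n : ℕ) :
    ((s.csMix n).σtot : ℝ) / s.h (n + 1) ≤ s.a n / s.h n := by
  have h1 : (0 : ℝ) < s.h n := by exact_mod_cast s.h_pos n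
  have h2 : (0 : ℝ) < s.q n := by exact_mod_cast (by have := s.two_le_q n; omega : 0 < s.q n)
  have h3 : (0 : ℝ) ≤ s.a n := Nat.cast_nonneg _
  rw [σtot_csMix, h_succ', H]
  push_cast
  rw [mul_div_mul_left _ _ h2.ne']
  gcongr
  linarith

/-- The mixing construction. -/
def mix : Adic s.Q s.h where
  h_zero := s.h_zero
  h_succ n := s.h_succ n
  two_le := s.two_le_Q
  p := s.csMix
  heights_eq := s.heights_csMix
  condF := by
    unfold CondF
    simp only [heights_csMix]
    refine Summable.of_nonneg_of_le (fun n => by positivity)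
      (fun n => (s.spacer_ratio_le n).trans (s.a_div_h_le n)) summable_geometric_two
  F := s.mixF
  F_lt _ _ _ ht hi := s.mixF_lt ht hi
  F_inj _ _ _ _ _ ht _ ht' _ he := s.mixF_inj ht ht' he
  col := s.mixCol
  col_lt _ _ hj := s.mixCol_lt hj
  F_col n j t hj _ := by rw [mixF_mixCol, s.colStart_csMix n j hj]

/-- The cutting and spacing parameters of the odometer. -/
def csOdo (n : ℕ) : CSParam where
  q := s.Q n
  two_le_q := s.two_le_Q n
  σ _ := 0
  σ_eq_zero_of_gt _ _ := rfl

lemma heights_csOdo (n : ℕ) : heights s.csOdo n = s.h n := by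
  induction n with
  | zero => simp [heights, s.h_zero]
  | succ n ih =>
    rw [heights, ih, s.h_succ]
    simp [CSParam.σtot, csOdo, Q, H, mul_comm]

/-- The odometer. -/
def odo : Adic s.Q s.h where
  h_zero := s.h_zero
  h_succ n := s.h_succ n
  two_le := s.two_le_Q
  p := s.csOdo
  heights_eq := s.heights_csOdo
  condF := by simp [CondF, CSParam.σtot, csOdo, summable_zero]
  F n t i := i * s.h n + t
  F_lt n t i ht hi := by
    rw [s.h_succ, mul_comm (s.h n)]
    exact mul_add_lt_mul hi ht
  F_inj n t i t' i' ht _ ht' _ he := (eq_and_eq_of_mul_add_eq ht ht' he).symm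
  col _ j := j
  col_lt _ _ hj := hj
  F_col n j t _ _ := by simp [colStart, csOdo, heights_csOdo]

lemma isUniversalOdometer_odo : IsUniversalOdometer (digitMeasure s.Q) s.odo.T := by
  refine ⟨s.csOdo, s.odo.isRankOneWith, fun _ _ => rfl, fun N hN => ⟨N, ?_⟩⟩
  obtain ⟨n, rfl⟩ : ∃ n, N = n + 1 := ⟨N - 1, by omega⟩
  rw [Finset.prod_range_succ]
  refine Dvd.dvd.mul_left ?_ _
  exact (s.dvd_K n).mul_right _

lemma abs_pos_sub_pos_le (n : ℕ) (x : Digits s.Q) :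
    |(s.mix.pos (n + 1) x : ℤ) - s.odo.pos (n + 1) x| ≤ (s.h n * s.H n : ℕ) := by
  set i : ℕ := (x n).val
  obtain ⟨κ, hκ⟩ : ∃ κ, i / s.H n = κ := ⟨_, rfl⟩
  have h1 : κ * (s.h n * s.H n) ≤ s.mix.pos (n + 1) x ∧
      s.mix.pos (n + 1) x < κ * (s.h n * s.H n) + s.h n * s.H n := by
    have e : s.mix.pos (n + 1) x = s.mixF n (s.mix.pos n x) i := rfl
    obtain ⟨r, hr, e'⟩ := s.exists_slot i (s.mix.pos_lt n x)
    have ho := s.offset_lt i (s.mix.pos_lt n x)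
    have h2 := mul_add_lt_mul hr ho
    rw [e, mixF_eq, e', hκ, add_mul, mul_assoc]
    omega
  have h2 : κ * (s.h n * s.H n) ≤ s.odo.pos (n + 1) x ∧
      s.odo.pos (n + 1) x < κ * (s.h n * s.H n) + s.h n * s.H n := by
    have e : s.odo.pos (n + 1) x = i * s.h n + s.odo.pos n x := rfl
    have h3 := mul_add_lt_mul (Nat.mod_lt i (s.H_pos n)) (s.odo.pos_lt n x)
    have h4 : i * s.h n = κ * (s.h n * s.H n) + i % s.H n * s.h n := by
      conv_lhs => rw [← Nat.div_add_mod i (s.H n), hκ]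
      ring
    rw [e, h4, mul_comm (s.h n) (s.H n)] at *
    omega
  rw [abs_le]
  omega

end Scheme

lemma SmallOCbrt.exists_bound {φ : ℝ → ℝ} (hφ0 : ∀ t : ℝ, 0 ≤ t → 0 ≤ φ t) (hφ : SmallOCbrt φ) :
    ∃ C : ℝ, 0 ≤ C ∧ ∀ k : ℕ, φ k ≤ C * ((k : ℝ) + 1) ^ ((1 : ℝ) / 3) := by
  have h1 : ∀ᶠ k : ℕ in atTop, φ k / (k : ℝ) ^ ((1 : ℝ) / 3) < 1 :=
    (hφ.comp tendsto_natCast_atTop_atTop).eventually_lt_const one_pos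
  obtain ⟨N, hN⟩ := eventually_atTop.1 h1
  have h0 : 0 ≤ ∑ k ∈ Finset.range (N + 1), φ k :=
    Finset.sum_nonneg fun k _ => hφ0 _ (Nat.cast_nonneg k)
  refine ⟨1 + ∑ k ∈ Finset.range (N + 1), φ k, by linarith, fun k => ?_⟩
  have hk1 : (1 : ℝ) ≤ ((k : ℝ) + 1) ^ ((1 : ℝ) / 3) :=
    Real.one_le_rpow (by linarith [Nat.cast_nonneg (α := ℝ) k]) (by norm_num)
  rcases lt_or_ge k (N + 1) with hk | hk
  · have h2 : φ k ≤ ∑ k ∈ Finset.range (N + 1), φ k :=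
      Finset.single_le_sum (f := fun k : ℕ => φ k) (fun k _ => hφ0 _ (Nat.cast_nonneg k))
        (Finset.mem_range.2 hk)
    nlinarith
  · have hkpos : (0 : ℝ) < k := by exact_mod_cast (by omega : 0 < k)
    have h2 := hN k (by omega)
    rw [div_lt_one (Real.rpow_pos_of_pos hkpos _)] at h2
    have h3 : (k : ℝ) ^ ((1 : ℝ) / 3) ≤ ((k : ℝ) + 1) ^ ((1 : ℝ) / 3) :=
      Real.rpow_le_rpow hkpos.le (by linarith) (by norm_num)
    nlinarith

namespace Scheme

variable (s : Scheme)

/-- The cube root of the height. -/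
noncomputable def cbrt (n : ℕ) : ℝ := (s.h n : ℝ) ^ ((1 : ℝ) / 3)

lemma cbrt_pos (n : ℕ) : 0 < s.cbrt n := Real.rpow_pos_of_pos (by exact_mod_cast s.h_pos n) _

lemma cbrt_pow (n : ℕ) : s.cbrt n ^ 3 = s.h n := by
  rw [cbrt, ← Real.rpow_natCast, ← Real.rpow_mul (Nat.cast_nonneg _)]
  norm_num

lemma cbrt_mono : Monotone s.cbrt := by
  refine monotone_nat_of_le_succ fun n => Real.rpow_le_rpow (Nat.cast_nonneg _) ?_ (by norm_num)
  have h1 := s.two_le_Q n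
  have h2 : s.h n ≤ s.h (n + 1) := by
    rw [s.h_succ]
    exact Nat.le_mul_of_pos_right _ (by change 0 < s.Q n; omega)
  exact_mod_cast h2

lemma add_two_div_le {n : ℕ} (hn : 1 ≤ n) :
    ((s.a n : ℝ) + 2) / s.h n ≤ (1 / 2) ^ n / s.cbrt n ^ 2 := by
  obtain ⟨m, rfl⟩ : ∃ m, n = m + 1 := ⟨n - 1, by omega⟩
  have hx := s.cbrt_pos (m + 1)
  have h1 : (((s.a (m + 1) : ℝ) + 2) * 2 ^ (m + 1)) ^ 3 ≤ s.cbrt (m + 1) ^ 3 := by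
    rw [cbrt_pow]; exact_mod_cast s.growth m
  have h2 := le_of_pow_le_pow_left₀ (by norm_num) hx.le h1
  rw [← cbrt_pow, one_div_pow, div_le_div_iff₀ (by positivity) (by positivity), div_mul_eq_mul_div,
    le_div_iff₀ (by positivity)]
  nlinarith [mul_le_mul_of_nonneg_right h2 (sq_nonneg (s.cbrt (m + 1)))]

lemma tailRatio_mix_le {n : ℕ} (hn : 1 ≤ n) :
    s.mix.tailRatio n ≤ 2 * (1 / 2) ^ n / s.cbrt n ^ 2 := by
  have hx := s.cbrt_pos n
  have h1 : HasSum (fun m : ℕ => ((1 : ℝ) / 2) ^ n / s.cbrt n ^ 2 * (1 / 2) ^ m)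
      (2 * (1 / 2) ^ n / s.cbrt n ^ 2) := by
    have := hasSum_geometric_two.mul_left (((1 : ℝ) / 2) ^ n / s.cbrt n ^ 2)
    rwa [div_mul_eq_mul_div, mul_comm _ (2 : ℝ)] at this
  rw [← h1.tsum_eq]
  refine Summable.tsum_le_tsum (fun m => ?_)
    ((summable_nat_add_iff n).2 s.mix.summable_spacerRatio) h1.summable
  calc s.mix.spacerRatio (m + n) ≤ s.a (m + n) / s.h (m + n) := s.spacer_ratio_le (m + n)
    _ ≤ (s.a (m + n) + 2) / s.h (m + n) := by gcongr; linarith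
    _ ≤ (1 / 2) ^ (m + n) / s.cbrt (m + n) ^ 2 := s.add_two_div_le (by omega)
    _ ≤ (1 / 2) ^ (m + n) / s.cbrt n ^ 2 := by
      gcongr
      exact s.cbrt_mono (by omega)
    _ = _ := by rw [pow_add]; ring

lemma window_rpow_le (n : ℕ) :
    (((2 * (s.h n * s.H n) + 1 : ℕ) : ℝ) + 1) ^ ((1 : ℝ) / 3) ≤ 2 * s.cbrt n ^ 2 := by
  have hx := s.cbrt_pos n
  have h1 : (1 : ℝ) ≤ s.h n := by exact_mod_cast s.h_pos n
  have h2 : (s.a n : ℝ) ≤ s.h n := by exact_mod_cast s.a_le_h n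
  have h3 : (2 * s.cbrt n ^ 2 : ℝ) = (8 * (s.h n : ℝ) ^ 2) ^ ((1 : ℝ) / 3) := by
    rw [← cbrt_pow, show 8 * (s.cbrt n ^ 3) ^ 2 = (2 * s.cbrt n ^ 2) ^ 3 by ring,
      ← Real.rpow_natCast (2 * s.cbrt n ^ 2) 3, ← Real.rpow_mul (by positivity)]
    norm_num
  rw [h3]
  refine Real.rpow_le_rpow (by positivity) ?_ (by norm_num)
  unfold H
  push_cast
  nlinarith

lemma tailRatio_odo (n : ℕ) : s.odo.tailRatio n = 0 := by
  have : ∀ m, s.odo.spacerRatio m = 0 := by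
    intro m
    simp [Adic.spacerRatio, odo, CSParam.σtot, csOdo]
  simp [Adic.tailRatio, this]

lemma phiIntegrablyOE {φ : ℝ → ℝ} (hφ0 : ∀ t : ℝ, 0 ≤ t → 0 ≤ φ t) (hφ : SmallOCbrt φ) :
    PhiIntegrablyOE (digitMeasure s.Q) s.mix.T (digitMeasure s.Q) s.odo.T φ := by
  obtain ⟨C, hC, hCφ⟩ := hφ.exists_bound hφ0
  refine s.mix.phiIntegrablyOE s.odo hφ0 (g := fun k => C * ((k : ℝ) + 1) ^ ((1 : ℝ) / 3))
    (ε := fun n => s.mix.tailRatio n + 2 / s.h n) ?_ hCφ s.abs_pos_sub_pos_le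
    (fun n => le_rfl) (fun n => ?_) ?_
  · intro k l hkl
    have : (k : ℝ) ≤ l := by exact_mod_cast hkl
    change C * ((k : ℝ) + 1) ^ ((1 : ℝ) / 3) ≤ C * ((l : ℝ) + 1) ^ ((1 : ℝ) / 3)
    gcongr
  · rw [tailRatio_odo]
    gcongr
    exact s.mix.tailRatio_nonneg n
  · rw [← summable_nat_add_iff 1]
    have h1 : Summable fun n : ℕ => 6 * C * ((1 : ℝ) / 2) ^ (n + 1) :=
      ((summable_nat_add_iff 1).2 summable_geometric_two).mul_left _
    refine Summable.of_nonneg_of_le (fun n => ?_) (fun n => ?_) h1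
    · have := s.mix.tailRatio_nonneg (n + 1)
      positivity
    · have hx := s.cbrt_pos (n + 1)
      have h2 := s.tailRatio_mix_le (n := n + 1) (by omega)
      have h3 := s.add_two_div_le (n := n + 1) (by omega)
      have h4 : (2 : ℝ) / s.h (n + 1) ≤ (s.a (n + 1) + 2) / s.h (n + 1) := by
        gcongr
        linarith [Nat.cast_nonneg (α := ℝ) (s.a (n + 1))]
      have h5 : s.mix.tailRatio (n + 1) + 2 / s.h (n + 1) ≤
          3 * (1 / 2) ^ (n + 1) / s.cbrt (n + 1) ^ 2 := by
        refine (add_le_add h2 (h4.trans h3)).trans (le_of_eq ?_)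
        ring
      have h6 := mul_le_mul_of_nonneg_left (s.window_rpow_le (n + 1)) hC
      refine (mul_le_mul h6 h5 ?_ (by positivity)).trans (le_of_eq ?_)
      · have := s.mix.tailRatio_nonneg (n + 1)
        positivity
      · field_simp
        ring

end Scheme

namespace Scheme

variable (s : Scheme)

/-- The levels of the `(n+1)`-st tower contained in given levels of the `n`-th one. -/
def up (n : ℕ) (S : Finset ℕ) : Finset ℕ :=
  (Finset.range (s.q n) ×ˢ S).image fun z => z.1 * s.H n + (s.b n z.1 + z.2)

variable {s}

lemma mem_up {n : ℕ} {S : Finset ℕ} {p : ℕ} :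
    p ∈ s.up n S ↔ ∃ j < s.q n, ∃ t ∈ S, j * s.H n + (s.b n j + t) = p := by
  simp only [up, Finset.mem_image, Finset.mem_product, Finset.mem_range, Prod.exists]
  constructor
  · rintro ⟨j, t, ⟨h1, h2⟩, h3⟩
    exact ⟨j, h1, t, h2, h3⟩
  · rintro ⟨j, h1, t, h2, h3⟩
    exact ⟨j, t, ⟨h1, h2⟩, h3⟩

lemma b_add_lt {n t : ℕ} (j : ℕ) (ht : t < s.h n) : s.b n j + t < s.H n := by
  have := s.b_lt n j
  unfold H; omega

lemma mem_up_iff {n : ℕ} {S : Finset ℕ} (hS : S ⊆ Finset.range (s.h n)) {j o : ℕ}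
    (ho : o < s.H n) :
    j * s.H n + o ∈ s.up n S ↔ j < s.q n ∧ ∃ t ∈ S, s.b n j + t = o := by
  rw [mem_up]
  constructor
  · rintro ⟨j', hj', t, ht, e⟩
    obtain ⟨rfl, rfl⟩ :=
      eq_and_eq_of_mul_add_eq (b_add_lt j' (Finset.mem_range.1 (hS ht))) ho e
    exact ⟨hj', t, ht, rfl⟩
  · rintro ⟨hj, t, ht, rfl⟩
    exact ⟨j, hj, t, ht, rfl⟩

lemma up_subset {n : ℕ} {S : Finset ℕ} (hS : S ⊆ Finset.range (s.h n)) :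
    s.up n S ⊆ Finset.range (s.h (n + 1)) := by
  intro p hp
  obtain ⟨j, hj, t, ht, rfl⟩ := mem_up.1 hp
  rw [Finset.mem_range, h_succ']
  exact mul_add_lt_mul hj (b_add_lt j (Finset.mem_range.1 (hS ht)))

lemma injOn_up {n : ℕ} {S : Finset ℕ} (hS : S ⊆ Finset.range (s.h n)) (R : Finset ℕ) :
    Set.InjOn (fun z : ℕ × ℕ => z.1 * s.H n + (s.b n z.1 + z.2)) (R ×ˢ S : Finset (ℕ × ℕ)) := by
  rintro ⟨j, t⟩ h1 ⟨j', t'⟩ h2 he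
  simp only [Finset.coe_product, mem_prod, Finset.mem_coe] at h1 h2
  obtain ⟨h3, h4⟩ := eq_and_eq_of_mul_add_eq (b_add_lt j (Finset.mem_range.1 (hS h1.2)))
    (b_add_lt j' (Finset.mem_range.1 (hS h2.2))) he
  subst h3
  simp only [Prod.mk.injEq, true_and]
  exact Nat.add_left_cancel h4

lemma card_up {n : ℕ} {S : Finset ℕ} (hS : S ⊆ Finset.range (s.h n)) :
    (s.up n S).card = s.q n * S.card := by
  rw [up, Finset.card_image_of_injOn (injOn_up hS _), Finset.card_product, Finset.card_range]

lemma card_filter_up {n : ℕ} {S : Finset ℕ} (hS : S ⊆ Finset.range (s.h n)) (P : ℕ → Prop)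
    [DecidablePred P] :
    ((s.up n S).filter P).card = ∑ t ∈ S,
      ((Finset.range (s.q n)).filter fun i => P (i * s.H n + (s.b n i + t))).card := by
  rw [Finset.card_filter, up, Finset.sum_image (injOn_up hS _), Finset.sum_product,
    Finset.sum_comm]
  simp only [Finset.card_filter]

lemma card_shift_of_lt {n : ℕ} {S : Finset ℕ} (hS : S ⊆ Finset.range (s.h n)) {k : ℕ}
    (hk : k < s.h n) :
    ((Finset.range (s.q n)).filter fun i => i * s.H n + (s.b n i + k) ∈ s.up n S).card =
      if k ∈ S then s.q n else 0 := by
  have h1 : ∀ i ∈ Finset.range (s.q n), (i * s.H n + (s.b n i + k) ∈ s.up n S ↔ k ∈ S) := by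
    intro i hi
    rw [mem_up_iff hS (b_add_lt i hk)]
    constructor
    · rintro ⟨-, t, ht, e⟩
      rwa [← (by omega : t = k)]
    · exact fun hkS => ⟨Finset.mem_range.1 hi, k, hkS, rfl⟩
  rw [Finset.filter_congr h1]
  split_ifs with hkS <;> simp [hkS]

lemma card_up_div {n : ℕ} {S : Finset ℕ} (hS : S ⊆ Finset.range (s.h n)) :
    ((s.up n S).card : ℝ) / s.h (n + 1) = S.card / s.H n := by
  have h1 : (s.q n : ℝ) ≠ 0 := by
    have := s.two_le_q n
    exact_mod_cast (by omega : s.q n ≠ 0)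
  rw [card_up hS, h_succ']
  push_cast
  rw [mul_div_mul_left _ _ h1]

lemma card_filter_lt_le {n : ℕ} {S : Finset ℕ} {j y : ℕ} (hy : y ≤ j * s.H n) :
    ((s.up n S).filter fun p => p < y).card ≤ j * S.card := by
  calc _ ≤ ((Finset.range j ×ˢ S).image fun z => z.1 * s.H n + (s.b n z.1 + z.2)).card := by
        apply Finset.card_le_card
        intro p hp
        obtain ⟨hp, hlt⟩ := Finset.mem_filter.1 hp
        obtain ⟨i, -, t, ht, rfl⟩ := mem_up.1 hp
        refine Finset.mem_image.2 ⟨(i, t), Finset.mem_product.2 ⟨Finset.mem_range.2 ?_, ht⟩, rfl⟩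
        by_contra hc
        have := Nat.mul_le_mul_right (s.H n) (not_lt.1 hc)
        dsimp only at this
        omega
    _ ≤ _ := Finset.card_image_le
    _ = _ := by simp

lemma le_card_filter_lt {n : ℕ} {S : Finset ℕ} (hS : S ⊆ Finset.range (s.h n)) {j y : ℕ}
    (hj : j ≤ s.q n) (hy : j * s.H n ≤ y) :
    j * S.card ≤ ((s.up n S).filter fun p => p < y).card := by
  calc j * S.card = (Finset.range j ×ˢ S).card := by simp
    _ = ((Finset.range j ×ˢ S).image fun z => z.1 * s.H n + (s.b n z.1 + z.2)).card :=
        (Finset.card_image_of_injOn (injOn_up hS _)).symm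
    _ ≤ _ := by
        apply Finset.card_le_card
        intro p hp
        obtain ⟨⟨i, t⟩, hz, rfl⟩ := Finset.mem_image.1 hp
        obtain ⟨hi, ht⟩ := Finset.mem_product.1 hz
        have hi := Finset.mem_range.1 hi
        have h1 := mul_add_lt_mul hi (b_add_lt i (Finset.mem_range.1 (hS ht)))
        exact Finset.mem_filter.2 ⟨mem_up.2 ⟨i, by omega, t, ht, rfl⟩, h1.trans_le hy⟩

/-- Discrepancy of the levels of a set in an initial segment of a tower. -/
lemma abs_card_filter_lt_sub_le {n : ℕ} {S : Finset ℕ} (hS : S ⊆ Finset.range (s.h n)) {y : ℕ}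
    (hy : y ≤ s.h (n + 1)) :
    |(((s.up n S).filter fun p => p < y).card : ℝ) - y * (S.card / s.H n)| ≤ s.H n := by
  have hH : (0 : ℝ) < s.H n := by exact_mod_cast s.H_pos n
  have e := Nat.div_add_mod y (s.H n)
  have l := Nat.mod_lt y (s.H_pos n)
  have hSc : (S.card : ℝ) ≤ s.H n := by
    have := Finset.card_le_card hS
    rw [Finset.card_range] at this
    exact_mod_cast this.trans (Nat.le_add_right _ _)
  have h1 : y / s.H n * S.card ≤ ((s.up n S).filter fun p => p < y).card := by
    refine le_card_filter_lt hS ?_ (Nat.div_mul_le_self _ _)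
    rw [h_succ'] at hy
    exact Nat.div_le_of_le_mul (by rwa [mul_comm])
  have h2 : ((s.up n S).filter fun p => p < y).card ≤ (y / s.H n + 1) * S.card := by
    apply card_filter_lt_le
    rw [add_mul, mul_comm]
    omega
  have h3 : (y : ℝ) * (S.card / s.H n) = (y / s.H n : ℕ) * S.card +
      (y % s.H n : ℕ) / s.H n * S.card := by
    have : (y : ℝ) = s.H n * (y / s.H n : ℕ) + (y % s.H n : ℕ) := by exact_mod_cast e.symm
    conv_lhs => rw [this]
    field_simp
  have h4 : ((y % s.H n : ℕ) : ℝ) / s.H n ≤ 1 := by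
    rw [div_le_one hH]; exact_mod_cast l.le
  have h5 : (0 : ℝ) ≤ ((y % s.H n : ℕ) : ℝ) / s.H n := by positivity
  have h6 : (((y / s.H n : ℕ) : ℝ) * S.card) ≤ (((s.up n S).filter fun p => p < y).card : ℝ) := by
    exact_mod_cast h1
  have h7 : (((s.up n S).filter fun p => p < y).card : ℝ) ≤ ((y / s.H n : ℕ) + 1) * S.card := by
    exact_mod_cast h2
  have h8 : (0 : ℝ) ≤ S.card := Nat.cast_nonneg _
  rw [h3, abs_le]
  constructor
  · nlinarith
  · nlinarith [mul_nonneg h5 h8]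

lemma abs_window_sub_le {n : ℕ} {S : Finset ℕ} (hS : S ⊆ Finset.range (s.h n)) {z : ℕ}
    (hz : s.a (n + 1) ≤ z + 1) (hz' : z + 1 ≤ s.h (n + 1)) :
    |(((Finset.range (s.a (n + 1))).filter fun v => z - v ∈ s.up n S).card : ℝ) / s.a (n + 1) -
      ((s.up n S).card : ℝ) / s.h (n + 1)| ≤ 2 / ((n : ℝ) + 2) := by
  have ha : (0 : ℝ) < s.a (n + 1) := by exact_mod_cast s.a_pos (n + 1)
  have hH : (0 : ℝ) < s.H n := by exact_mod_cast s.H_pos n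
  have h1 : ((Finset.range (s.a (n + 1))).filter fun v => z - v ∈ s.up n S).card =
      ((s.up n S).filter fun p => p < z + 1 ∧ ¬ p < z + 1 - s.a (n + 1)).card := by
    refine Finset.card_bij' (fun v _ => z - v) (fun p _ => z - p) ?_ ?_ ?_ ?_
    · intro v hv
      simp only [Finset.mem_filter, Finset.mem_range] at hv ⊢
      exact ⟨hv.2, by omega, by omega⟩
    · intro p hp
      simp only [Finset.mem_filter, Finset.mem_range] at hp ⊢
      refine ⟨by omega, ?_⟩
      rw [Nat.sub_sub_self (by omega)]
      exact hp.1
    · intro v hv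
      simp only [Finset.mem_filter, Finset.mem_range] at hv
      omega
    · intro p hp
      simp only [Finset.mem_filter] at hp
      omega
  have h2 : ((s.up n S).filter fun p => p < z + 1 ∧ ¬ p < z + 1 - s.a (n + 1)).card +
      ((s.up n S).filter fun p => p < z + 1 - s.a (n + 1)).card =
      ((s.up n S).filter fun p => p < z + 1).card := by
    rw [← Finset.card_union_of_disjoint]
    · congr 1
      ext p
      simp only [Finset.mem_union, Finset.mem_filter]
      constructor
      · rintro (⟨h3, h4, -⟩ | ⟨h3, h4⟩)
        · exact ⟨h3, h4⟩
        · exact ⟨h3, by omega⟩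
      · rintro ⟨h3, h4⟩
        by_cases h5 : p < z + 1 - s.a (n + 1)
        · exact Or.inr ⟨h3, h5⟩
        · exact Or.inl ⟨h3, h4, h5⟩
    · rw [Finset.disjoint_left]
      intro p hp hp'
      exact (Finset.mem_filter.1 hp).2.2 (Finset.mem_filter.1 hp').2
  have h3 := abs_le.1 (abs_card_filter_lt_sub_le hS hz')
  have h4 := abs_le.1 (abs_card_filter_lt_sub_le hS
    (show z + 1 - s.a (n + 1) ≤ s.h (n + 1) by omega))
  rw [Nat.cast_sub hz] at h4
  have h5 : ((((Finset.range (s.a (n + 1))).filter fun v => z - v ∈ s.up n S).card : ℕ) : ℝ) +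
      (((s.up n S).filter fun p => p < z + 1 - s.a (n + 1)).card : ℝ) =
      (((s.up n S).filter fun p => p < z + 1).card : ℝ) := by
    rw [h1]; exact_mod_cast h2
  have h6 : |(((Finset.range (s.a (n + 1))).filter fun v => z - v ∈ s.up n S).card : ℝ) -
      s.a (n + 1) * (S.card / s.H n)| ≤ 2 * s.H n := by
    rw [abs_le]
    constructor <;> linarith
  rw [card_up_div hS]
  have h7 : (((Finset.range (s.a (n + 1))).filter fun v => z - v ∈ s.up n S).card : ℝ) /
      s.a (n + 1) - S.card / s.H n =
      ((((Finset.range (s.a (n + 1))).filter fun v => z - v ∈ s.up n S).card : ℝ) -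
      s.a (n + 1) * (S.card / s.H n)) / s.a (n + 1) := by
    field_simp
  have h8 : (s.a (n + 1) : ℝ) = (n + 2) * s.H n := by
    rw [s.a_succ]; push_cast [H]; ring
  rw [h7, abs_div, abs_of_pos ha, div_le_div_iff₀ ha (by positivity)]
  calc _ ≤ 2 * (s.H n : ℝ) * (n + 2) := by gcongr
    _ = 2 * s.a (n + 1) := by rw [h8]; ring

lemma filter_shift_eq {n : ℕ} {B : Finset ℕ} (hB : B ⊆ Finset.range (s.h n)) {k : ℕ}
    (hr : s.a n ≤ k % s.H n) (hr' : k % s.H n + s.a n ≤ s.h n) :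
    ((Finset.range (s.q n)).filter fun i => i * s.H n + (s.b n i + k) ∈ s.up n B) =
      (Finset.range (s.q n - k / s.H n)).filter fun i =>
        k % s.H n + s.b n i - s.b n (i + k / s.H n) ∈ B := by
  ext i
  have e := Nat.div_add_mod k (s.H n)
  have hb := s.b_lt n i
  have hb' := s.b_lt n (i + k / s.H n)
  have h1 : i * s.H n + (s.b n i + k) = (i + k / s.H n) * s.H n + (s.b n i + k % s.H n) := by
    rw [add_mul, mul_comm (k / s.H n)]; omega
  simp only [Finset.mem_filter, Finset.mem_range]
  have hH : s.H n = s.h n + s.a n := rfl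
  rw [h1, mem_up_iff hB (by omega)]
  constructor
  · rintro ⟨h2, h3, t, ht, e'⟩
    refine ⟨by omega, ?_⟩
    rwa [show k % s.H n + s.b n i - s.b n (i + k / s.H n) = t by omega]
  · rintro ⟨h2, h3⟩
    exact ⟨h2.trans_le (Nat.sub_le _ _), by omega, _, h3, by omega⟩

/-- For most shifts, the translates of the levels of the copies of a tower meet a given set
in the expected proportion. -/
lemma abs_card_shift_sub_le {m : ℕ} {S : Finset ℕ} (hS : S ⊆ Finset.range (s.h m)) {k : ℕ}
    (hr : s.a (m + 1) ≤ k % s.H (m + 1)) (hr' : k % s.H (m + 1) + s.a (m + 1) ≤ s.h (m + 1))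
    (hk : 1 ≤ k / s.H (m + 1)) :
    |(((Finset.range (s.q (m + 1))).filter fun i =>
        i * s.H (m + 1) + (s.b (m + 1) i + k) ∈ s.up (m + 1) (s.up m S)).card : ℝ) -
      (s.q (m + 1) - k / s.H (m + 1) : ℕ) * ((s.up m S).card / s.h (m + 1))| ≤
      3 * s.q (m + 1) / ((m : ℝ) + 2) := by
  rw [filter_shift_eq (up_subset hS) hr hr']
  set n := m + 1
  set l := k / s.H n
  set r := k % s.H n
  set B := s.up m S
  set N := s.q n - l
  have hNq : (N : ℝ) ≤ s.q n := by exact_mod_cast Nat.sub_le _ _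
  rcases Nat.eq_zero_or_pos N with hN | hN
  · rw [hN]
    simp only [Finset.range_zero, Finset.filter_empty, Finset.card_empty, Nat.cast_zero, zero_mul,
      sub_zero, abs_zero]
    positivity
  have h1 := s.equi n (fun u v => r + u - v ∈ B) l N hk (by change N + l ≤ s.q n; omega)
  have hq : ((s.h n * s.K n : ℕ) : ℝ) = s.q n := rfl
  have hn : ((n : ℕ) : ℝ) + 1 = m + 2 := by simp only [n]; push_cast; ring
  rw [hq, hn, Finset.sum_sub_distrib] at h1
  have h2 : |(∑ i ∈ Finset.range N,
      (((Finset.range (s.a n)).filter fun v => r + s.b n i - v ∈ B).card : ℝ) / s.a n) -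
      N * (B.card / s.h n)| ≤ N * (2 / ((m : ℝ) + 2)) := by
    have h3 : (N : ℝ) * (B.card / s.h n) = ∑ i ∈ Finset.range N, (B.card : ℝ) / s.h n := by simp
    rw [h3, ← Finset.sum_sub_distrib]
    refine (Finset.abs_sum_le_sum_abs _ _).trans ?_
    refine (Finset.sum_le_sum (g := fun _ => 2 / ((m : ℝ) + 2)) fun i _ => ?_).trans (by simp)
    have hb := s.b_lt n i
    have hl : s.a n ≤ r + s.b n i + 1 := by omega
    have hl' : r + s.b n i + 1 ≤ s.h n := by omega
    exact abs_window_sub_le hS hl hl'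
  rw [Finset.card_filter]
  push_cast
  refine (abs_sub_le _ _ _).trans ((add_le_add h1 h2).trans ?_)
  have h4 : (N : ℝ) * (2 / ((m : ℝ) + 2)) ≤ s.q n * (2 / ((m : ℝ) + 2)) := by gcongr
  refine (add_le_add le_rfl h4).trans (le_of_eq ?_)
  field_simp
  ring

end Scheme

namespace Scheme

variable {s : Scheme}

lemma card_bad_shift_le (n k : ℕ) :
    ((Finset.range (s.h n)).filter fun t =>
      ¬(s.a n ≤ (t + k) % s.H n ∧ (t + k) % s.H n + s.a n ≤ s.h n)).card ≤ 3 * s.a n := by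
  have hH : s.H n = s.h n + s.a n := rfl
  have hah := s.a_le_h n
  calc _ ≤ (Finset.range (s.a n) ∪ Finset.Ioo (s.h n - s.a n) (s.H n)).card := by
        refine Finset.card_le_card_of_injOn (fun t => (t + k) % s.H n) ?_ ?_
        · intro t ht
          have h1 := (Finset.mem_filter.1 ht).2
          have h2 := Nat.mod_lt (t + k) (s.H_pos n)
          simp only [Finset.coe_union, Finset.coe_range, Finset.coe_Ioo, mem_union, mem_Iio,
            mem_Ioo]
          omega
        · intro t ht t' ht' he
          have h1 := Finset.mem_range.1 (Finset.mem_filter.1 ht).1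
          have h2 := Finset.mem_range.1 (Finset.mem_filter.1 ht').1
          have h3 : t ≡ t' [MOD s.H n] := Nat.ModEq.add_right_cancel' k he
          exact h3.eq_of_lt_of_lt (by omega) (by omega)
    _ ≤ (Finset.range (s.a n)).card + (Finset.Ioo (s.h n - s.a n) (s.H n)).card :=
        Finset.card_union_le _ _
    _ ≤ _ := by
        rw [Finset.card_range, Nat.card_Ioo]
        omega

lemma card_shift_lt {n k : ℕ} (hr' : k % s.H n + s.a n ≤ s.h n) :
    ((Finset.range (s.q n)).filter fun i => i * s.H n + (s.b n i + k) < s.h (n + 1)).card =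
      s.q n - k / s.H n := by
  rw [← Finset.card_range (s.q n - k / s.H n)]
  congr 1
  ext i
  have e := Nat.div_add_mod k (s.H n)
  have hb := s.b_lt n i
  have hH : s.H n = s.h n + s.a n := rfl
  have h1 : i * s.H n + (s.b n i + k) = (i + k / s.H n) * s.H n + (s.b n i + k % s.H n) := by
    rw [add_mul, mul_comm (k / s.H n)]; omega
  have h2 : s.b n i + k % s.H n < s.H n := by omega
  simp only [Finset.mem_filter, Finset.mem_range]
  rw [h1, h_succ']
  constructor
  · rintro ⟨-, h3⟩
    have : i + k / s.H n < s.q n := by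
      by_contra hc
      have := Nat.mul_le_mul_right (s.H n) (not_lt.1 hc)
      omega
    omega
  · intro h3
    exact ⟨h3.trans_le (Nat.sub_le _ _), mul_add_lt_mul (by omega) h2⟩

lemma card_div_h_mem_Icc {n : ℕ} {B : Finset ℕ} (hB : B ⊆ Finset.range (s.h n)) :
    0 ≤ (B.card : ℝ) / s.h n ∧ (B.card : ℝ) / s.h n ≤ 1 := by
  have h1 : (0 : ℝ) < s.h n := by exact_mod_cast s.h_pos n
  have h2 := Finset.card_le_card hB
  rw [Finset.card_range] at h2
  exact ⟨by positivity, (div_le_one h1).2 (by exact_mod_cast h2)⟩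

lemma abs_sub_mul_le_of_le {x y q β : ℝ} (hx : 0 ≤ x) (hxq : x ≤ q) (hy : 0 ≤ y) (hyq : y ≤ q)
    (hβ : 0 ≤ β ∧ β ≤ 1) : |x - y * β| ≤ q := by
  have h1 := mul_nonneg hy hβ.1
  have h2 := mul_le_of_le_one_right hy hβ.2
  rw [abs_le]
  constructor <;> linarith

lemma abs_card_pairs_sub_le {m : ℕ} {A S : Finset ℕ} (hA : A ⊆ Finset.range (s.h (m + 1)))
    (hS : S ⊆ Finset.range (s.h m)) {k : ℕ} (hk : s.h (m + 1) ≤ k) :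
    |(((s.up (m + 1) A).filter fun u => u + k ∈ s.up (m + 1) (s.up m S)).card : ℝ) -
      ((s.up (m + 1) A).filter fun u => u + k < s.h (m + 1 + 1)).card *
        ((s.up m S).card / s.h (m + 1))| ≤
      s.h (m + 1) * (3 * s.q (m + 1) / ((m : ℝ) + 2)) + 3 * s.a (m + 1) * s.q (m + 1) := by
  have hB := up_subset hS
  have hβ := card_div_h_mem_Icc hB
  rw [card_filter_up hA, card_filter_up hA]
  push_cast
  rw [Finset.sum_mul, ← Finset.sum_sub_distrib]
  refine (Finset.abs_sum_le_sum_abs _ _).trans ?_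
  set G : ℕ → Prop := fun t => ¬(s.a (m + 1) ≤ (t + k) % s.H (m + 1) ∧
    (t + k) % s.H (m + 1) + s.a (m + 1) ≤ s.h (m + 1))
  calc _ ≤ ∑ t ∈ A, (3 * (s.q (m + 1) : ℝ) / ((m : ℝ) + 2) +
        if G t then (s.q (m + 1) : ℝ) else 0) := by
        refine Finset.sum_le_sum fun t ht => ?_
        have e (i : ℕ) : i * s.H (m + 1) + (s.b (m + 1) i + t) + k =
            i * s.H (m + 1) + (s.b (m + 1) i + (t + k)) := by omega
        simp only [e]
        split_ifs with hG
        · refine (abs_sub_mul_le_of_le (Nat.cast_nonneg _) ?_ (Nat.cast_nonneg _) ?_ hβ).trans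
            (le_add_of_nonneg_left (by positivity))
          · exact_mod_cast (Finset.card_filter_le _ _).trans (Finset.card_range _).le
          · exact_mod_cast (Finset.card_filter_le _ _).trans (Finset.card_range _).le
        · obtain ⟨hr, hr'⟩ := not_not.1 hG
          have hl : 1 ≤ (t + k) / s.H (m + 1) := by
            by_contra hc
            have e := Nat.div_add_mod (t + k) (s.H (m + 1))
            rw [Nat.lt_one_iff.1 (not_le.1 hc)] at e
            have := s.a_pos (m + 1)
            omega
          have h1 := abs_card_shift_sub_le hS hr hr' hl
          rw [card_shift_lt hr', add_zero]
          exact h1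
    _ ≤ ∑ t ∈ Finset.range (s.h (m + 1)), (3 * (s.q (m + 1) : ℝ) / ((m : ℝ) + 2) +
        if G t then (s.q (m + 1) : ℝ) else 0) :=
        Finset.sum_le_sum_of_subset_of_nonneg hA fun _ _ _ => by positivity
    _ = s.h (m + 1) * (3 * (s.q (m + 1) : ℝ) / ((m : ℝ) + 2)) +
        ((Finset.range (s.h (m + 1))).filter G).card * s.q (m + 1) := by
        rw [Finset.sum_add_distrib, ← Finset.sum_filter]
        simp
    _ ≤ _ := by
        have h1 : (((Finset.range (s.h (m + 1))).filter G).card : ℝ) ≤ 3 * s.a (m + 1) := by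
          exact_mod_cast card_bad_shift_le (m + 1) k
        gcongr

lemma abs_density_up_sub_le {n : ℕ} {B : Finset ℕ} (hB : B ⊆ Finset.range (s.h n)) :
    |((s.up n B).card : ℝ) / s.h (n + 1) - B.card / s.h n| ≤ s.a n / s.h n := by
  have h1 : (0 : ℝ) < s.h n := by exact_mod_cast s.h_pos n
  have h2 : (0 : ℝ) < s.H n := by exact_mod_cast s.H_pos n
  have hH : (s.H n : ℝ) = s.h n + s.a n := by exact_mod_cast (rfl : s.H n = s.h n + s.a n)
  have h3 : (0 : ℝ) ≤ s.a n := Nat.cast_nonneg _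
  have hβ := card_div_h_mem_Icc hB
  have h4 : (B.card : ℝ) ≤ s.h n := by rw [← div_le_one h1]; exact hβ.2
  have h5 : (B.card : ℝ) / s.h n - B.card / s.H n = B.card / s.H n * (s.a n / s.h n) := by
    field_simp
    rw [hH]; ring
  rw [card_up_div hB, abs_sub_comm, h5, abs_of_nonneg (by positivity)]
  refine mul_le_of_le_one_left (by positivity) ?_
  rw [div_le_one h2, hH]
  linarith

/-- The number of times a shift sends the levels of a set to those of another one. -/
def pairs (s : Scheme) (n k : ℕ) (A B : Finset ℕ) : ℕ :=
  ((s.up (n + 1) (s.up n A)).filter fun p => p + k ∈ s.up (n + 1) (s.up n B)).card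

/-- A bound for the correlations. -/
noncomputable def err (s : Scheme) (m : ℕ) : ℝ :=
  3 / ((m : ℝ) + 2) + 3 / ((m : ℝ) + 3) + 4 * (s.a (m + 1) / s.h (m + 1)) +
    1 / s.q (m + 2) + 2 * (s.a (m + 2) / s.h (m + 2))

lemma abs_card_shift_high_sub_le {n : ℕ} {B : Finset ℕ} (hB : B ⊆ Finset.range (s.h n)) {v : ℕ}
    (hv : s.h (n + 1) + 2 * s.a (n + 1) ≤ v) (hv' : v < 2 * s.h (n + 1)) :
    |(((Finset.range (s.q (n + 1))).filter fun i =>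
        i * s.H (n + 1) + (s.b (n + 1) i + v) ∈ s.up (n + 1) (s.up n B)).card : ℝ) -
      s.q (n + 1) * (B.card / s.h n)| ≤
      3 * s.q (n + 1) / ((n : ℝ) + 2) + 1 + s.q (n + 1) * (s.a n / s.h n) := by
  have hH : s.H (n + 1) = s.h (n + 1) + s.a (n + 1) := rfl
  have e1 : v / s.H (n + 1) = 1 := by
    rw [Nat.div_eq_iff (s.H_pos _)]; omega
  have e2 : v % s.H (n + 1) = v - s.H (n + 1) := by
    have := Nat.div_add_mod v (s.H (n + 1))
    rw [e1] at this; omega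
  have h1 := abs_card_shift_sub_le hB (k := v) (by omega) (by omega) e1.ge
  have hq := s.two_le_q (n + 1)
  rw [e1, Nat.cast_sub (by omega), Nat.cast_one] at h1
  have h2 := abs_density_up_sub_le hB
  have hβ := card_div_h_mem_Icc (up_subset hB)
  set β := (B.card : ℝ) / s.h n
  set β' := ((s.up n B).card : ℝ) / s.h (n + 1)
  have h3 : |((s.q (n + 1) : ℝ) - 1) * β' - s.q (n + 1) * β| ≤
      1 + s.q (n + 1) * (s.a n / s.h n) := by
    have : ((s.q (n + 1) : ℝ) - 1) * β' - s.q (n + 1) * β = s.q (n + 1) * (β' - β) - β' := by ring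
    rw [this]
    refine (abs_sub _ _).trans ?_
    rw [abs_mul, Nat.abs_cast, abs_of_nonneg hβ.1, add_comm]
    gcongr
    exact hβ.2
  refine (abs_sub_le _ _ _).trans ((add_le_add h1 h3).trans (le_of_eq ?_))
  ring

lemma abs_pairs_sub_le {m : ℕ} {A S : Finset ℕ} (hA : A ⊆ Finset.range (s.h (m + 1)))
    (hS : S ⊆ Finset.range (s.h m)) {k : ℕ} (hk : s.h (m + 1) ≤ k) (hk' : k < s.h (m + 2)) :
    |(s.pairs (m + 1) k A (s.up m S) : ℝ) -
      s.q (m + 2) * (s.up (m + 1) A).card * ((s.up m S).card / s.h (m + 1))| ≤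
      s.q (m + 2) * s.h (m + 2) * s.err m := by
  have hB := up_subset hS
  have hβ := card_div_h_mem_Icc hB
  have hA' := up_subset hA
  have hD := abs_card_pairs_sub_le hA hS hk
  set B := s.up m S
  set β := (B.card : ℝ) / s.h (m + 1) with hβdef
  set N : ℕ → ℕ := fun u => ((Finset.range (s.q (m + 2))).filter fun i =>
      i * s.H (m + 2) + (s.b (m + 2) i + (u + k)) ∈ s.up (m + 2) (s.up (m + 1) B)).card with hN
  have hpairs : (s.pairs (m + 1) k A B : ℝ) = ∑ u ∈ s.up (m + 1) A, (N u : ℝ) := by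
    rw [pairs, card_filter_up hA']
    push_cast
    refine Finset.sum_congr rfl fun u _ => ?_
    simp only [hN, add_assoc]
  set U := s.up (m + 1) A
  set lo := U.filter fun u => u + k < s.h (m + 2) with hlo
  set hi := U.filter fun u => ¬ u + k < s.h (m + 2) with hhi
  have hsplit : ∑ u ∈ U, (N u : ℝ) = ∑ u ∈ lo, (N u : ℝ) + ∑ u ∈ hi, (N u : ℝ) :=
    (Finset.sum_filter_add_sum_filter_not _ _ _).symm
  have hcard : (U.card : ℝ) = lo.card + hi.card := by
    exact_mod_cast (Finset.card_filter_add_card_filter_not _).symm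
  have hlosum : ∑ u ∈ lo, (N u : ℝ) =
      s.q (m + 2) * ((U.filter fun u => u + k ∈ s.up (m + 1) B).card : ℝ) := by
    have h1 : ∀ u ∈ lo, (N u : ℝ) = if u + k ∈ s.up (m + 1) B then (s.q (m + 2) : ℝ) else 0 := by
      intro u hu
      have h2 := card_shift_of_lt (up_subset hB) (Finset.mem_filter.1 hu).2
      simp only [hN]
      rw [h2]
      split_ifs <;> simp
    rw [Finset.sum_congr rfl h1, ← Finset.sum_filter, Finset.sum_const, nsmul_eq_mul, mul_comm,
      hlo, Finset.filter_filter]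
    congr 3
    refine Finset.filter_congr fun u _ => ⟨fun h => h.2, fun h => ⟨?_, h⟩⟩
    exact Finset.mem_range.1 (up_subset hB h)
  have hhisum : |∑ u ∈ hi, (N u : ℝ) - hi.card * (s.q (m + 2) * β)| ≤
      s.h (m + 2) * (3 * s.q (m + 2) / ((m : ℝ) + 3) + 1 +
        s.q (m + 2) * (s.a (m + 1) / s.h (m + 1))) + 2 * s.a (m + 2) * s.q (m + 2) := by
    rw [← nsmul_eq_mul, ← Finset.sum_const, ← Finset.sum_sub_distrib]
    refine (Finset.abs_sum_le_sum_abs _ _).trans ?_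
    set G : ℕ → Prop := fun u => s.h (m + 2) ≤ u + k ∧ u + k < s.h (m + 2) + 2 * s.a (m + 2)
    have hG : ((Finset.range (s.h (m + 2))).filter G).card ≤ 2 * s.a (m + 2) := by
      calc _ ≤ (Finset.Ico (s.h (m + 2) - k) (s.h (m + 2) + 2 * s.a (m + 2) - k)).card := by
            refine Finset.card_le_card fun u hu => ?_
            have := (Finset.mem_filter.1 hu).2
            simp only [G] at this
            rw [Finset.mem_Ico]
            omega
        _ ≤ _ := by rw [Nat.card_Ico]; omega
    calc _ ≤ ∑ u ∈ hi, (3 * (s.q (m + 2) : ℝ) / ((m : ℝ) + 3) + 1 +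
        s.q (m + 2) * (s.a (m + 1) / s.h (m + 1)) + if G u then (s.q (m + 2) : ℝ) else 0) := by
          refine Finset.sum_le_sum fun u hu => ?_
          obtain ⟨hu1, hu2⟩ := Finset.mem_filter.1 hu
          have hu3 := Finset.mem_range.1 (hA' hu1)
          change u < s.h (m + 2) at hu3
          split_ifs with hGu
          · refine (abs_sub_mul_le_of_le (Nat.cast_nonneg _) ?_ (Nat.cast_nonneg _) le_rfl
              hβ).trans (le_add_of_nonneg_left (by positivity))
            exact_mod_cast (Finset.card_filter_le _ _).trans (Finset.card_range _).le
          · simp only [G] at hGu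
            have h1 := abs_card_shift_high_sub_le hB (v := u + k)
              (show s.h (m + 2) + 2 * s.a (m + 2) ≤ u + k by omega)
              (show u + k < 2 * s.h (m + 2) by omega)
            rw [add_zero]
            refine h1.trans (le_of_eq ?_)
            push_cast
            ring
      _ ≤ ∑ u ∈ Finset.range (s.h (m + 2)), (3 * (s.q (m + 2) : ℝ) / ((m : ℝ) + 3) + 1 +
        s.q (m + 2) * (s.a (m + 1) / s.h (m + 1)) + if G u then (s.q (m + 2) : ℝ) else 0) :=
          Finset.sum_le_sum_of_subset_of_nonneg ((Finset.filter_subset _ _).trans hA')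
            fun _ _ _ => by positivity
      _ = s.h (m + 2) * (3 * (s.q (m + 2) : ℝ) / ((m : ℝ) + 3) + 1 +
        s.q (m + 2) * (s.a (m + 1) / s.h (m + 1))) +
          ((Finset.range (s.h (m + 2))).filter G).card * s.q (m + 2) := by
          rw [Finset.sum_add_distrib, ← Finset.sum_filter]
          simp only [Finset.sum_const, nsmul_eq_mul, Finset.card_range]
      _ ≤ _ := by
          have : (((Finset.range (s.h (m + 2))).filter G).card : ℝ) ≤ 2 * s.a (m + 2) := by
            exact_mod_cast hG
          gcongr
  have h1 : (0 : ℝ) < s.h (m + 1) := by exact_mod_cast s.h_pos _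
  have h2 : (0 : ℝ) < s.h (m + 2) := by exact_mod_cast s.h_pos _
  have hq : (0 : ℝ) < s.q (m + 2) := by
    exact_mod_cast (by have := s.two_le_q (m + 2); omega : 0 < s.q (m + 2))
  have hqh : (s.q (m + 1) : ℝ) * s.h (m + 1) ≤ s.h (m + 2) := by
    have : s.q (m + 1) * s.h (m + 1) ≤ s.h (m + 2) := by
      rw [s.h_succ' (m + 1)]
      exact Nat.mul_le_mul_left _ (Nat.le_add_right _ _)
    exact_mod_cast this
  have e1 : (s.h (m + 1) : ℝ) * (3 * s.q (m + 1) / ((m : ℝ) + 2)) +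
      3 * s.a (m + 1) * s.q (m + 1) ≤
      s.h (m + 2) * (3 / ((m : ℝ) + 2) + 3 * (s.a (m + 1) / s.h (m + 1))) := by
    have : (s.h (m + 1) : ℝ) * (3 * s.q (m + 1) / ((m : ℝ) + 2)) +
        3 * s.a (m + 1) * s.q (m + 1) = (s.q (m + 1) * s.h (m + 1)) *
        (3 / ((m : ℝ) + 2) + 3 * (s.a (m + 1) / s.h (m + 1))) := by
      field_simp
    rw [this]
    gcongr
  have h3 : (s.pairs (m + 1) k A B : ℝ) - s.q (m + 2) * U.card * β =
      s.q (m + 2) * ((U.filter fun u => u + k ∈ s.up (m + 1) B).card - lo.card * β) +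
      (∑ u ∈ hi, (N u : ℝ) - hi.card * (s.q (m + 2) * β)) := by
    rw [hpairs, hsplit, hlosum, hcard]
    ring
  rw [h3]
  refine (abs_add_le _ _).trans ?_
  rw [abs_mul, Nat.abs_cast]
  refine (add_le_add (mul_le_mul_of_nonneg_left (hD.trans e1) hq.le) hhisum).trans (le_of_eq ?_)
  rw [err]
  field_simp
  ring

lemma abs_pairs_div_sub_le {m : ℕ} {A S : Finset ℕ} (hA : A ⊆ Finset.range (s.h (m + 1)))
    (hS : S ⊆ Finset.range (s.h m)) {k : ℕ} (hk : s.h (m + 1) ≤ k) (hk' : k < s.h (m + 2)) :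
    |(s.pairs (m + 1) k A (s.up m S) : ℝ) / s.h (m + 3) -
      ((s.up (m + 2) (s.up (m + 1) A)).card : ℝ) / s.h (m + 3) *
        ((s.up m S).card / s.h (m + 1))| ≤ s.err m := by
  have h1 := abs_pairs_sub_le hA hS hk hk'
  have h2 : (0 : ℝ) < s.h (m + 3) := by exact_mod_cast s.h_pos _
  have h3 : ((s.up (m + 2) (s.up (m + 1) A)).card : ℝ) =
      s.q (m + 2) * (s.up (m + 1) A).card := by
    exact_mod_cast card_up (up_subset hA)
  have h4 : (s.q (m + 2) : ℝ) * s.h (m + 2) ≤ s.h (m + 3) := by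
    have : s.q (m + 2) * s.h (m + 2) ≤ s.h (m + 3) := by
      rw [s.h_succ' (m + 2)]
      exact Nat.mul_le_mul_left _ (Nat.le_add_right _ _)
    exact_mod_cast this
  have h5 : 0 ≤ s.err m := by unfold err; positivity
  rw [div_mul_eq_mul_div, ← sub_div, abs_div, abs_of_pos h2, div_le_iff₀ h2, h3, mul_comm (s.err m)]
  exact h1.trans (mul_le_mul_of_nonneg_right h4 h5)

lemma tendsto_a_div_h : Tendsto (fun n => (s.a n : ℝ) / s.h n) atTop (𝓝 0) :=
  squeeze_zero (fun n => by positivity) s.a_div_h_le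
    (tendsto_pow_atTop_nhds_zero_of_lt_one (by norm_num) (by norm_num))

lemma tendsto_h_atTop : Tendsto s.h atTop atTop := by
  refine tendsto_atTop_mono (fun n => ?_) tendsto_id
  have h1 := s.growth_le n
  have h2 := s.a_pos n
  have h3 : n < 2 ^ n := Nat.lt_two_pow_self
  have h4 : 2 ^ n ≤ s.a n * 2 ^ n := Nat.le_mul_of_pos_left _ h2
  change n ≤ s.h n
  omega

lemma tendsto_one_div_q : Tendsto (fun n => (1 : ℝ) / s.q n) atTop (𝓝 0) := by
  have h1 : Tendsto s.q atTop atTop :=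
    tendsto_atTop_mono (fun n => Nat.le_mul_of_pos_right _
      (Nat.lt_of_lt_of_le two_pos (s.two_le_K n))) tendsto_h_atTop
  simp only [one_div]
  exact tendsto_inv_atTop_zero.comp (tendsto_natCast_atTop_atTop.comp h1)

lemma tendsto_err : Tendsto s.err atTop (𝓝 0) := by
  have h1 (c : ℝ) : Tendsto (fun m : ℕ => 3 / ((m : ℝ) + c)) atTop (𝓝 0) :=
    Tendsto.div_atTop tendsto_const_nhds
      (tendsto_atTop_add_const_right _ _ tendsto_natCast_atTop_atTop)
  have h2 := ((((h1 2).add (h1 3)).add (((tendsto_add_atTop_iff_nat 1).2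
    (s.tendsto_a_div_h)).const_mul 4)).add ((tendsto_add_atTop_iff_nat 2).2
    s.tendsto_one_div_q)).add (((tendsto_add_atTop_iff_nat 2).2 (s.tendsto_a_div_h)).const_mul 2)
  rw [show (0 : ℝ) = 0 + 0 + 4 * 0 + 0 + 2 * 0 by norm_num]
  exact h2

end Scheme

section StronglyMixing

variable {X : Type} [MeasurableSpace X] {μ : Measure X} [IsProbabilityMeasure μ]

lemma abs_measureReal_sub_le {U V E : Set X} (hE : ∀ x ∉ E, x ∈ U ↔ x ∈ V) :
    |μ.real U - μ.real V| ≤ μ.real E := by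
  have h1 : ∀ U V : Set X, (∀ x ∉ E, x ∈ U → x ∈ V) → μ.real U ≤ μ.real V + μ.real E := by
    intro U V hUV
    have h2 : U ⊆ V ∪ E := by
      intro x hx
      by_cases hxE : x ∈ E
      · exact Or.inr hxE
      · exact Or.inl (hUV x hxE hx)
    exact (measureReal_mono h2).trans (measureReal_union_le _ _)
  rw [abs_sub_le_iff]
  constructor
  · linarith [h1 U V fun x hx => (hE x hx).1]
  · linarith [h1 V U fun x hx => (hE x hx).2]

lemma abs_correlation_sub_correlation_le {T : X → X} (hT : MeasurePreserving T μ μ)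
    {U U' V V' E F : Set X} (hF : MeasurableSet F) (hUU : ∀ x ∉ E, x ∈ U ↔ x ∈ U')
    (hVV : ∀ x ∉ F, x ∈ V ↔ x ∈ V') (k : ℕ) :
    |μ.real (U ∩ T^[k] ⁻¹' V) - μ.real (U' ∩ T^[k] ⁻¹' V')| ≤ μ.real E + μ.real F := by
  have h1 : μ.real (T^[k] ⁻¹' F) = μ.real F :=
    (hT.iterate k).measureReal_preimage hF.nullMeasurableSet
  rw [← h1]
  refine (abs_measureReal_sub_le (E := E ∪ T^[k] ⁻¹' F) fun x hx => ?_).trans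
    (measureReal_union_le _ _)
  simp only [mem_union, mem_preimage, not_or] at hx
  exact and_congr (hUU x hx.1) (hVV _ hx.2)

/-- Strong mixing can be tested on a dense family of sets. -/
lemma stronglyMixing_of_measureDense {T : X → X} (hT : MeasurePreserving T μ μ)
    {𝒜 : Set (Set X)} (h𝒜 : μ.MeasureDense 𝒜)
    (hmix : ∀ A ∈ 𝒜, ∀ B ∈ 𝒜, Tendsto (fun k : ℕ =>
      |μ.real (A ∩ T^[k] ⁻¹' B) - μ.real A * μ.real B|) atTop (𝓝 0)) :
    StronglyMixing μ T := by
  have happrox : ∀ A : Set X, MeasurableSet A → ∀ ε : ℝ, 0 < ε → ∃ A' ∈ 𝒜, ∃ E,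
      MeasurableSet E ∧ μ.real E < ε ∧ ∀ x ∉ E, x ∈ A ↔ x ∈ A' := by
    intro A hA ε hε
    obtain ⟨A', hA', hlt⟩ := h𝒜.approx A hA (measure_ne_top _ _) ε hε
    refine ⟨A', hA', symmDiff A A', hA.symmDiff (h𝒜.measurable _ hA'), ?_, fun x hx => ?_⟩
    · exact (ENNReal.lt_ofReal_iff_toReal_lt (measure_ne_top _ _)).1 hlt
    · rw [mem_symmDiff] at hx
      tauto
  intro A B hA hB
  change Tendsto (fun k : ℕ => |μ.real (A ∩ T^[k] ⁻¹' B) - μ.real A * μ.real B|) atTop (𝓝 0)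
  rw [Metric.tendsto_atTop]
  intro ε hε
  obtain ⟨A', hA', E, hE, hEε, hAA⟩ := happrox A hA (ε / 5) (by positivity)
  obtain ⟨B', hB', F, hF, hFε, hBB⟩ := happrox B hB (ε / 5) (by positivity)
  obtain ⟨N, hN⟩ := Metric.tendsto_atTop.1 (hmix A' hA' B' hB') (ε / 5) (by positivity)
  refine ⟨N, fun k hk => ?_⟩
  have h1 := hN k hk
  rw [Real.dist_eq, sub_zero, abs_abs, abs_lt] at h1
  have h2 := abs_correlation_sub_correlation_le hT hF hAA hBB k
  have h3 := abs_measureReal_sub_le (μ := μ) hAA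
  have h4 := abs_measureReal_sub_le (μ := μ) hBB
  have h5 : |μ.real A' * μ.real B' - μ.real A * μ.real B| ≤ μ.real E + μ.real F := by
    have e : μ.real A' * μ.real B' - μ.real A * μ.real B =
        (μ.real A' - μ.real A) * μ.real B' + μ.real A * (μ.real B' - μ.real B) := by ring
    rw [e]
    refine (abs_add_le _ _).trans ?_
    rw [abs_mul, abs_mul, abs_of_nonneg (measureReal_nonneg (μ := μ) (s := B')),
      abs_of_nonneg (measureReal_nonneg (μ := μ) (s := A)), abs_sub_comm (μ.real A'),
      abs_sub_comm (μ.real B')]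
    exact add_le_add
      ((mul_le_of_le_one_right (abs_nonneg _) measureReal_le_one).trans h3)
      ((mul_le_of_le_one_left (abs_nonneg _) measureReal_le_one).trans h4)
  rw [Real.dist_eq, sub_zero, abs_abs, abs_lt]
  rw [abs_le] at h2 h5
  constructor <;> linarith

end StronglyMixing

namespace Scheme

variable (s : Scheme)

lemma pos_mem_iff_of_mem_dom {n : ℕ} {S : Finset ℕ} (hS : S ⊆ Finset.range (s.h n))
    {x : Digits s.Q} (hx : x ∈ s.mix.dom n) : s.mix.pos n x ∈ S ↔ s.mix.pos (n + 1) x ∈ s.up n S := by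
  obtain ⟨j, hj, hc⟩ := hx n le_rfl
  have h1 : j < s.q n := hj
  have h2 := s.mix.pos_succ_of_col hj hc
  have h3 : colStart s.mix.p n j = j * s.H n + s.b n j := s.colStart_csMix n j h1
  rw [h2, h3, add_assoc, mem_up_iff hS (b_add_lt j (s.mix.pos_lt n x))]
  constructor
  · exact fun h => ⟨h1, _, h, rfl⟩
  · rintro ⟨-, t, ht, e⟩
    rwa [← Nat.add_left_cancel e]

lemma abs_mix_correlation_sub_le {m k : ℕ} {R R' : Finset ℕ} (hR : R ⊆ Finset.range (s.h m))
    (hR' : R' ⊆ Finset.range (s.h m)) (hk : s.h (m + 1) ≤ k) (hk' : k < s.h (m + 2)) :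
    |(digitMeasure s.Q).real ({x | s.mix.pos m x ∈ R} ∩ (s.mix.T)^[k] ⁻¹' {x | s.mix.pos m x ∈ R'})
      - (digitMeasure s.Q).real {x | s.mix.pos m x ∈ R} *
        (digitMeasure s.Q).real {x | s.mix.pos m x ∈ R'}| ≤
      4 * s.mix.tailRatio m + s.mix.tailRatio (m + 3) + 2 * (1 / s.q (m + 2)) + s.err m := by
  set μ := digitMeasure s.Q
  have hup {S : Finset ℕ} (hS : S ⊆ Finset.range (s.h m)) : ∀ x ∉ (s.mix.dom m)ᶜ,
      (s.mix.pos m x ∈ S ↔ s.mix.pos (m + 1) x ∈ s.up m S) ∧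
      (s.mix.pos m x ∈ S ↔ s.mix.pos (m + 3) x ∈ s.up (m + 2) (s.up (m + 1) (s.up m S))) := by
    intro x hx
    have hx := not_not.1 hx
    have h1 := s.pos_mem_iff_of_mem_dom hS hx
    have h2 := s.pos_mem_iff_of_mem_dom (up_subset hS) (s.mix.dom_mono (by omega) hx)
    have h3 := s.pos_mem_iff_of_mem_dom (up_subset (up_subset hS))
      (s.mix.dom_mono (by omega) hx)
    exact ⟨h1, h1.trans (h2.trans h3)⟩
  have hdom := s.mix.digitMeasure_dom_compl m
  have hcorr := (abs_correlation_sub_correlation_le (μ := μ) s.mix.measurePreserving_T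
    (s.mix.measurableSet_dom m).compl (U := {x | s.mix.pos m x ∈ R})
    (U' := {x | s.mix.pos (m + 3) x ∈ s.up (m + 2) (s.up (m + 1) (s.up m R))})
    (V := {x | s.mix.pos m x ∈ R'})
    (V' := {x | s.mix.pos (m + 3) x ∈ s.up (m + 2) (s.up (m + 1) (s.up m R'))})
    (fun x hx => (hup hR x hx).2) (fun x hx => (hup hR' x hx).2) k).trans (add_le_add hdom hdom)
  have hcount := s.mix.abs_correlation_sub_le (m + 3) k _
    (s.up (m + 2) (s.up (m + 1) (s.up m R'))) (up_subset (up_subset (up_subset hR)))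
  have hpairs := abs_pairs_div_sub_le (up_subset hR) hR' hk hk'
  have hA := (abs_measureReal_sub_le (μ := μ) (U := {x | s.mix.pos m x ∈ R})
    (V := {x | s.mix.pos (m + 3) x ∈ s.up (m + 2) (s.up (m + 1) (s.up m R))})
    fun x hx => (hup hR x hx).2).trans hdom
  have hB := (abs_measureReal_sub_le (μ := μ) (U := {x | s.mix.pos m x ∈ R'})
    (V := {x | s.mix.pos (m + 1) x ∈ s.up m R'}) fun x hx => (hup hR' x hx).1).trans hdom
  rw [s.mix.digitMeasure_pos_mem (m + 3) _ (up_subset (up_subset (up_subset hR)))] at hA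
  rw [s.mix.digitMeasure_pos_mem (m + 1) _ (up_subset hR')] at hB
  have hk2 : 2 * (k : ℝ) / s.h (m + 3) ≤ 2 * (1 / s.q (m + 2)) := by
    have h1 : (0 : ℝ) < s.h (m + 3) := by exact_mod_cast s.h_pos _
    have h2 : (0 : ℝ) < s.q (m + 2) := by
      exact_mod_cast (by have := s.two_le_q (m + 2); omega : 0 < s.q (m + 2))
    have h3 : k * s.q (m + 2) ≤ s.h (m + 3) := by
      rw [s.h_succ' (m + 2), mul_comm]
      exact Nat.mul_le_mul_left _ (hk'.le.trans (Nat.le_add_right _ _))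
    have h4 : (k : ℝ) * s.q (m + 2) ≤ s.h (m + 3) := by exact_mod_cast h3
    rw [mul_div_assoc]
    refine mul_le_mul_of_nonneg_left ?_ two_pos.le
    rw [div_le_div_iff₀ h1 h2]
    linarith
  set α := μ.real {x | s.mix.pos m x ∈ R}
  set β := μ.real {x | s.mix.pos m x ∈ R'}
  set α' := ((s.up (m + 2) (s.up (m + 1) (s.up m R))).card : ℝ) / s.h (m + 3)
  set β' := ((s.up m R').card : ℝ) / s.h (m + 1)
  have hβ' : 0 ≤ β' ∧ β' ≤ 1 := card_div_h_mem_Icc (up_subset hR')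
  have hprod : |α' * β' - α * β| ≤ 2 * s.mix.tailRatio m := by
    have e : α' * β' - α * β = (α' - α) * β' + α * (β' - β) := by ring
    rw [e, two_mul]
    refine (abs_add_le _ _).trans ?_
    rw [abs_mul, abs_mul, abs_of_nonneg hβ'.1,
      abs_of_nonneg (measureReal_nonneg : 0 ≤ α), abs_sub_comm α', abs_sub_comm β']
    exact add_le_add
      ((mul_le_of_le_one_right (abs_nonneg _) hβ'.2).trans hA)
      ((mul_le_of_le_one_left (abs_nonneg _) measureReal_le_one).trans hB)
  have h1 := hcount.trans (add_le_add le_rfl hk2)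
  refine (abs_sub_le _ _ _).trans ((add_le_add hcorr ((abs_sub_le _ _ _).trans
    (add_le_add h1 ((abs_sub_le _ _ _).trans (add_le_add hpairs hprod))))).trans (le_of_eq ?_))
  ring

lemma monotone_h : Monotone s.h := by
  refine monotone_nat_of_le_succ fun n => ?_
  rw [s.h_succ']
  exact (Nat.le_add_right (s.h n) (s.a n)).trans
    (Nat.le_mul_of_pos_left (s.H n) (two_pos.trans_le (s.two_le_q n)))

theorem stronglyMixing : StronglyMixing (digitMeasure s.Q) s.mix.T := by
  refine stronglyMixing_of_measureDense s.mix.measurePreserving_T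
    (Measure.MeasureDense.of_generateFrom_isSetAlgebra_finite _ s.mix.isSetAlgebra_cylinders
      s.mix.generateFrom_cylinders) ?_
  rintro _ ⟨n₁, S, hS, rfl⟩ _ ⟨n₂, S', hS', rfl⟩
  have hlim : Tendsto (fun m => 4 * s.mix.tailRatio m + s.mix.tailRatio (m + 3) +
      2 * (1 / s.q (m + 2)) + s.err m) atTop (𝓝 0) := by
    rw [show (0 : ℝ) = 4 * 0 + 0 + 2 * 0 + 0 by norm_num]
    exact (((s.mix.tendsto_tailRatio.const_mul 4).add
      ((tendsto_add_atTop_iff_nat 3).2 s.mix.tendsto_tailRatio)).add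
      (((tendsto_add_atTop_iff_nat 2).2 s.tendsto_one_div_q).const_mul 2)).add s.tendsto_err
  rw [Metric.tendsto_atTop]
  intro ε hε
  obtain ⟨M, hM⟩ := eventually_atTop.1 (hlim.eventually (gt_mem_nhds hε))
  refine ⟨s.h (max M (max n₁ n₂) + 1), fun k hk => ?_⟩
  have hex : ∃ n, k < s.h n := (s.tendsto_h_atTop.eventually_gt_atTop k).exists
  obtain ⟨N, hN, hmin⟩ : ∃ N, k < s.h N ∧ ∀ n < N, s.h n ≤ k := by
    classical
    exact ⟨Nat.find hex, Nat.find_spec hex, fun n hn => not_lt.1 (Nat.find_min hex hn)⟩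
  have hNM : max M (max n₁ n₂) + 1 < N := by
    by_contra hc
    exact absurd (hk.trans_lt hN) (not_lt.2 (s.monotone_h (not_lt.1 hc)))
  obtain ⟨m, rfl⟩ : ∃ m, N = m + 2 := ⟨N - 2, by omega⟩
  obtain ⟨R, hR, e⟩ := s.mix.exists_cylinder_of_le (show n₁ ≤ m by omega) S
  obtain ⟨R', hR', e'⟩ := s.mix.exists_cylinder_of_le (show n₂ ≤ m by omega) S'
  rw [e, e', Real.dist_eq, sub_zero, abs_abs]
  exact (s.abs_mix_correlation_sub_le hR hR' (hmin _ (by omega)) hN).trans_lt (hM m (by omega))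

end Scheme

/-- For every map `φ : [0,∞) → [0,∞)` with `φ(t) = o(t^{1/3})`, there
exists a strongly mixing rank-one system which is `φ`-integrably orbit equivalent to the
universal odometer. -/
theorem exists_strongly_mixing_rank_one_phi_OE_to_universal_odometer
    (φ : ℝ → ℝ) (hφ0 : ∀ t : ℝ, 0 ≤ t → 0 ≤ φ t) (hφ : SmallOCbrt φ) :
    ∃ 𝒮 : MSystem, 𝒮.Standard ∧ IsRankOne 𝒮.μ 𝒮.T ∧ StronglyMixing 𝒮.μ (⇑𝒮.T) ∧
      PhiOEToUnivOdometer 𝒮.μ 𝒮.T φ := by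
  obtain ⟨s⟩ := exists_scheme
  exact ⟨⟨Digits s.Q, digitMeasure s.Q, s.mix.T⟩, s.mix.standard_of_adic _,
    ⟨_, s.mix.isRankOneWith⟩, s.stronglyMixing,
    ⟨Digits s.Q, digitMeasure s.Q, s.odo.T⟩, s.mix.standard_of_adic _,
    s.isUniversalOdometer_odo, s.phiIntegrablyOE hφ0 hφ⟩
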